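/- arXiv:2601.19780 — 6 statements merged into one kernel-verified Lean document; each statement's English description precedes it below -/
import Mathlib

section
/- Let L be an integral lattice such that −id belongs to the Weyl group W(L). Then the roots of L span L⊗ℚ (the root system of L has the same rank as L), and the group L♯/L is killed by 2, i.e., 2x ∈ L for every x ∈ L♯. -/
open Matrix

/-- The Weyl group of the integral lattice `ℤⁿ` with Gram matrix `P`: the subgroup of
`GLₙ(ℤ)` (as units of the matrix ring, acting by `mulVec`) generated by the orthogonal
reflections `sₐ(x) = x − (x·α)α` along the roots `α` (vectors of norm 2). -/
def weylGroup {n : ℕ} (P : Matrix (Fin n) (Fin n) ℤ) :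
    Subgroup (Matrix (Fin n) (Fin n) ℤ)ˣ :=
  Subgroup.closure {g | ∃ α : Fin n → ℤ, α ⬝ᵥ P *ᵥ α = 2 ∧
    (g : Matrix (Fin n) (Fin n) ℤ) = 1 - vecMulVec α (P *ᵥ α)}

/-- Action of an integer matrix on rational vectors. -/
noncomputable def ratAct {n : ℕ} (g : Matrix (Fin n) (Fin n) ℤ) (y : Fin n → ℚ) : Fin n → ℚ :=
  ((Int.castRingHom ℚ).mapMatrix g) *ᵥ y

lemma ratAct_mul {n : ℕ} (g h : Matrix (Fin n) (Fin n) ℤ) (y : Fin n → ℚ) :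
    ratAct (g * h) y = ratAct g (ratAct h y) := by
  simp only [ratAct, map_mul, mulVec_mulVec]

lemma ratAct_one {n : ℕ} (y : Fin n → ℚ) : ratAct 1 y = y := by
  simp only [ratAct, map_one, one_mulVec]

lemma ratAct_sub {n : ℕ} (g : Matrix (Fin n) (Fin n) ℤ) (y z : Fin n → ℚ) :
    ratAct g (y - z) = ratAct g y - ratAct g z := by
  simp only [ratAct, mulVec_sub]

lemma ratAct_cast {n : ℕ} (g : Matrix (Fin n) (Fin n) ℤ) (z : Fin n → ℤ) :
    ratAct g (fun i => (z i : ℚ)) = fun i => (((g *ᵥ z) i : ℤ) : ℚ) := by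
  ext i
  simp [ratAct, mulVec, dotProduct]

lemma ratAct_refl {n : ℕ} (P : Matrix (Fin n) (Fin n) ℤ) (α : Fin n → ℤ) (y : Fin n → ℚ) :
    ratAct (1 - vecMulVec α (P *ᵥ α)) y - y =
      (-(y ⬝ᵥ (P.map ((↑) : ℤ → ℚ)) *ᵥ (fun i => (α i : ℚ)))) • fun i => (α i : ℚ) := by
  have h : (Int.castRingHom ℚ).mapMatrix (vecMulVec α (P *ᵥ α)) =
      vecMulVec (fun i => (α i : ℚ)) ((P.map ((↑) : ℤ → ℚ)) *ᵥ (fun i => (α i : ℚ))) := by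
    ext i j
    simp [vecMulVec, mulVec, dotProduct]
  unfold ratAct
  rw [map_sub, map_one, h, sub_mulVec, one_mulVec, vecMulVec_mulVec, dotProduct_comm]
  ext i
  simp [mul_comm]

/-- If `−id` lies in the Weyl group of an integral lattice `L` (here `L = ℤⁿ` with Gram
matrix `P`), then the roots of `L` span `L ⊗ ℚ`, and the group `L♯/L` is killed by 2:
every `y ∈ L♯` (i.e. `y ∈ ℚⁿ` pairing integrally with `L`) satisfies `2y ∈ L`. -/
theorem roots_span_and_dual_killed_by_two_of_neg_one_mem_weyl
    {n : ℕ} (P : Matrix (Fin n) (Fin n) ℤ) (hsymm : P.IsSymm)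
    (hpos : ∀ x : Fin n → ℤ, x ≠ 0 → 0 < x ⬝ᵥ P *ᵥ x)
    (hW : (-1 : (Matrix (Fin n) (Fin n) ℤ)ˣ) ∈ weylGroup P) :
    (Submodule.span ℚ {v : Fin n → ℚ | ∃ α : Fin n → ℤ,
        α ⬝ᵥ P *ᵥ α = 2 ∧ v = fun i => (α i : ℚ)} = ⊤) ∧
    (∀ y : Fin n → ℚ,
      (∀ x : Fin n → ℤ, ∃ k : ℤ,
        y ⬝ᵥ (P.map ((↑) : ℤ → ℚ)) *ᵥ (fun i => (x i : ℚ)) = (k : ℚ)) →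
      ∃ z : Fin n → ℤ, (fun i => ((z i : ℚ))) = 2 • y) := by
  have hneg : ∀ y : Fin n → ℚ,
      ratAct ((-1 : (Matrix (Fin n) (Fin n) ℤ)ˣ) : Matrix (Fin n) (Fin n) ℤ) y = -y := by
    intro y
    rw [Units.val_neg, Units.val_one, ratAct, map_neg, map_one, neg_mulVec, one_mulVec]
  constructor
  · set S := Submodule.span ℚ {v : Fin n → ℚ | ∃ α : Fin n → ℤ,
        α ⬝ᵥ P *ᵥ α = 2 ∧ v = fun i => (α i : ℚ)} with hS
    have key : ∀ y : Fin n → ℚ,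
        ratAct ((-1 : (Matrix (Fin n) (Fin n) ℤ)ˣ) : Matrix (Fin n) (Fin n) ℤ) y - y ∈ S := by
      refine Subgroup.closure_induction
        (p := fun (g : (Matrix (Fin n) (Fin n) ℤ)ˣ) _ => ∀ y : Fin n → ℚ, ratAct (g : Matrix (Fin n) (Fin n) ℤ) y - y ∈ S)
        ?_ ?_ ?_ ?_ hW
      · rintro g ⟨α, hα, hg⟩ y
        rw [hg, ratAct_refl]
        exact S.smul_mem _ (Submodule.subset_span ⟨α, hα, rfl⟩)
      · intro y
        rw [Units.val_one, ratAct_one, sub_self]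
        exact S.zero_mem
      · intro g h _ _ hg hh y
        rw [Units.val_mul, ratAct_mul]
        have := S.add_mem (hg (ratAct h y)) (hh y)
        rwa [sub_add_sub_cancel] at this
      · intro g _ hg y
        have := hg (ratAct ((g⁻¹ : (Matrix (Fin n) (Fin n) ℤ)ˣ) : Matrix (Fin n) (Fin n) ℤ) y)
        rw [← ratAct_mul, Units.mul_inv, ratAct_one] at this
        simpa using S.neg_mem this
    rw [eq_top_iff]
    intro y _
    have := S.smul_mem (-(1/2) : ℚ) (key y)
    rw [hneg] at this
    convert this using 1
    ext i
    simp
    ring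
  · intro y hy
    have key : ∃ z : Fin n → ℤ, (fun i => (z i : ℚ)) =
        ratAct ((-1 : (Matrix (Fin n) (Fin n) ℤ)ˣ) : Matrix (Fin n) (Fin n) ℤ) y - y := by
      refine Subgroup.closure_induction
        (p := fun (g : (Matrix (Fin n) (Fin n) ℤ)ˣ) _ => ∃ z : Fin n → ℤ, (fun i => (z i : ℚ)) =
          ratAct (g : Matrix (Fin n) (Fin n) ℤ) y - y)
        ?_ ?_ ?_ ?_ hW
      · rintro g ⟨α, hα, hg⟩
        obtain ⟨k, hk⟩ := hy α
        refine ⟨(-k) • α, ?_⟩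
        rw [hg, ratAct_refl, hk]
        ext i
        simp
      · refine ⟨0, ?_⟩
        rw [Units.val_one, ratAct_one, sub_self]
        ext i
        simp
      · rintro g h _ _ ⟨a, ha⟩ ⟨b, hb⟩
        refine ⟨(g : Matrix (Fin n) (Fin n) ℤ) *ᵥ b + a, ?_⟩
        have e : (fun i => ((((g : Matrix (Fin n) (Fin n) ℤ) *ᵥ b + a) i : ℤ) : ℚ)) =
            (fun i => ((((g : Matrix (Fin n) (Fin n) ℤ) *ᵥ b) i : ℤ) : ℚ))
              + fun i => (a i : ℚ) := by
          ext i
          simp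
        rw [e, ← ratAct_cast, ha, hb, ratAct_sub, Units.val_mul, ratAct_mul, sub_add_sub_cancel]
      · rintro g _ ⟨a, ha⟩
        refine ⟨-(((g⁻¹ : (Matrix (Fin n) (Fin n) ℤ)ˣ) : Matrix (Fin n) (Fin n) ℤ) *ᵥ a), ?_⟩
        have e := ratAct_cast ((g⁻¹ : (Matrix (Fin n) (Fin n) ℤ)ˣ) : Matrix (Fin n) (Fin n) ℤ) a
        rw [ha, ratAct_sub, ← ratAct_mul, Units.inv_mul, ratAct_one] at e
        ext i
        have := congrFun e i
        simp only [Pi.sub_apply, Pi.neg_apply, Int.cast_neg] at this ⊢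
        rw [← this]
        ring
    obtain ⟨z, hz⟩ := key
    refine ⟨-z, ?_⟩
    rw [hneg] at hz
    ext i
    have := congrFun hz i
    simp only [Pi.sub_apply, Pi.neg_apply, Int.cast_neg, Pi.smul_apply, nsmul_eq_mul] at this ⊢
    rw [this]
    push_cast
    ring
end

section
/- Let L be a unimodular integral lattice, let A ⊆ L be a saturated sublattice (i.e., L/A is torsion-free), and let B = L ∩ A^⊥ = {x ∈ L : x·a = 0 for all a ∈ A}. Then B is an even lattice if and only if A contains a characteristic vector of L. -/
open Matrix

lemma aux_symm {n : ℕ} (P : Matrix (Fin n) (Fin n) ℤ) (hsymm : P.IsSymm)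
    (x y : Fin n → ℤ) : x ⬝ᵥ P *ᵥ y = y ⬝ᵥ P *ᵥ x := by
  rw [Matrix.dotProduct_mulVec, ← Matrix.mulVec_transpose, hsymm.eq, dotProduct_comm]

lemma aux_rep {n : ℕ} (P : Matrix (Fin n) (Fin n) ℤ) (hdet : P.det = 1)
    (f : (Fin n → ℤ) →ₗ[ℤ] ℤ) : ∃ z, ∀ x, x ⬝ᵥ P *ᵥ z = f x := by
  refine ⟨P⁻¹ *ᵥ (fun i => f (Pi.single i 1)), fun x => ?_⟩
  rw [Matrix.mulVec_mulVec, Matrix.mul_nonsing_inv _ (by simp [hdet]), Matrix.one_mulVec]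
  rw [LinearMap.pi_apply_eq_sum_univ f x]
  simp only [dotProduct, smul_eq_mul]
  refine Finset.sum_congr rfl fun i _ => ?_
  congr 2
  ext j
  simp [Pi.single_apply, eq_comm]

lemma aux_parity {n : ℕ} (P : Matrix (Fin n) (Fin n) ℤ) (hsymm : P.IsSymm) :
    ∃ q : (Fin n → ℤ) →ₗ[ℤ] ℤ, ∀ x, (2 : ℤ) ∣ q x - x ⬝ᵥ P *ᵥ x := by
  let q : (Fin n → ℤ) →ₗ[ℤ] ℤ := ∑ i, P i i • LinearMap.proj i
  refine ⟨q, fun x => ?_⟩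
  let g : (Fin n → ℤ) →+ ZMod 2 :=
    { toFun := fun x => ((x ⬝ᵥ P *ᵥ x : ℤ) : ZMod 2)
      map_zero' := by simp
      map_add' := fun x y => by
        have h2 : ((2 : ℤ) : ZMod 2) = 0 := by decide
        have : (x + y) ⬝ᵥ P *ᵥ (x + y) = x ⬝ᵥ P *ᵥ x + y ⬝ᵥ P *ᵥ y + 2 * (x ⬝ᵥ P *ᵥ y) := by
          rw [Matrix.mulVec_add, add_dotProduct, dotProduct_add, dotProduct_add,
            aux_symm P hsymm y x]
          ring
        rw [this, Int.cast_add, Int.cast_mul, h2]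
        simp }
  let k : (Fin n → ℤ) →+ ZMod 2 := (Int.castAddHom (ZMod 2)).comp q.toAddMonoidHom
  have : k = g := by
    ext i
    simp [k, g, q, Pi.single_apply]
  have hx := DFunLike.congr_fun this x
  have hx' : ((q x : ℤ) : ZMod 2) = ((x ⬝ᵥ P *ᵥ x : ℤ) : ZMod 2) := hx
  have := (ZMod.intCast_zmod_eq_zero_iff_dvd (q x - x ⬝ᵥ P *ᵥ x) 2).1 (by
    rw [Int.cast_sub, hx', sub_self])
  exact_mod_cast this

lemma aux_free {n : ℕ} (A : Submodule ℤ (Fin n → ℤ))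
    (hsat : ∀ (c : ℤ) (x : Fin n → ℤ), c ≠ 0 → c • x ∈ A → x ∈ A) :
    Module.Free ℤ ((Fin n → ℤ) ⧸ A) := by
  have : Module.IsTorsionFree ℤ ((Fin n → ℤ) ⧸ A) := by
    rw [Module.isTorsionFree_iff_smul_eq_zero]
    intro c m
    obtain ⟨x, rfl⟩ := A.mkQ_surjective m
    intro h
    by_cases hc : c = 0
    · exact Or.inl hc
    · right
      rw [← map_smul] at h
      simp only [Submodule.mkQ_apply, Submodule.Quotient.mk_eq_zero] at h ⊢
      exact hsat c x hc h
  infer_instance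

/-- Let `L = ℤⁿ` (Gram matrix `P`) be a unimodular integral lattice, `A ⊆ L` a saturated
sublattice and `B = L ∩ A^⊥`. Then `B` is even if and only if `A` contains a
characteristic vector of `L`. -/
theorem orthogonal_even_iff_char_mem
    {n : ℕ} (P : Matrix (Fin n) (Fin n) ℤ) (hsymm : P.IsSymm)
    (hpos : ∀ x : Fin n → ℤ, x ≠ 0 → 0 < x ⬝ᵥ P *ᵥ x) (hdet : P.det = 1)
    (A : Submodule ℤ (Fin n → ℤ))
    (hsat : ∀ (c : ℤ) (x : Fin n → ℤ), c ≠ 0 → c • x ∈ A → x ∈ A) :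
    (∀ x : Fin n → ℤ, (∀ a ∈ A, a ⬝ᵥ P *ᵥ x = 0) → Even (x ⬝ᵥ P *ᵥ x)) ↔
    (∃ ξ ∈ A, ∀ x : Fin n → ℤ, 2 ∣ (x ⬝ᵥ P *ᵥ ξ - x ⬝ᵥ P *ᵥ x)) := by
  constructor
  · intro hB
    let B : Submodule ℤ (Fin n → ℤ) :=
      { carrier := {x | ∀ a ∈ A, a ⬝ᵥ P *ᵥ x = 0}
        zero_mem' := by intro a _; simp
        add_mem' := by
          intro x y hx hy a ha
          rw [Matrix.mulVec_add, dotProduct_add, hx a ha, hy a ha, add_zero]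
        smul_mem' := by
          intro c x hx a ha
          rw [Matrix.mulVec_smul, dotProduct_smul, hx a ha, smul_zero] }
    have hBf : Module.Free ℤ ((Fin n → ℤ) ⧸ B) := aux_free B (by
      intro c x hc hx a ha
      have := hx a ha
      rw [Matrix.mulVec_smul, dotProduct_smul, smul_eq_mul] at this
      exact (mul_eq_zero.1 this).resolve_left hc)
    have hAf := aux_free A hsat
    obtain ⟨q, hq⟩ := aux_parity P hsymm
    obtain ⟨s, hs⟩ := Module.projective_lifting_property B.mkQ LinearMap.id B.mkQ_surjective
    obtain ⟨ξ, hξ⟩ := aux_rep P hdet (q ∘ₗ s ∘ₗ B.mkQ)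
    refine ⟨ξ, ?_, fun x => ?_⟩
    · rw [← Submodule.Quotient.mk_eq_zero, ← Module.forall_dual_apply_eq_zero_iff ℤ]
      intro f
      obtain ⟨z, hz⟩ := aux_rep P hdet (f ∘ₗ A.mkQ)
      have hzB : z ∈ B := by
        intro a ha
        rw [hz a]
        simp [(Submodule.Quotient.mk_eq_zero A).2 ha]
      have h1 := hz ξ
      have h2 := hξ z
      rw [aux_symm P hsymm] at h1
      have h3 : B.mkQ z = 0 := by simpa using hzB
      simp only [LinearMap.comp_apply, h3, map_zero] at h2
      rw [h2] at h1
      exact h1.symm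
    · have hb : x - s (B.mkQ x) ∈ B := by
        rw [← Submodule.Quotient.mk_eq_zero, ← Submodule.mkQ_apply, map_sub]
        have := LinearMap.congr_fun hs (B.mkQ x)
        simp only [LinearMap.comp_apply, LinearMap.id_apply] at this
        rw [this, sub_self]
      have h1 := (hB _ hb).two_dvd
      have h2 := hq (x - s (B.mkQ x))
      have h3 := hq x
      rw [hξ x]
      simp only [LinearMap.comp_apply]
      rw [map_sub] at h2
      omega
  · rintro ⟨ξ, hξA, hξ⟩ x hx
    have h := hξ x
    rw [aux_symm P hsymm x ξ, hx ξ hξA, zero_sub, dvd_neg] at h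
    exact even_iff_two_dvd.2 h
end

section
/- Let U be a unimodular integral lattice of rank n+2, and let α, β ∈ U satisfy α·α = β·β = 2, α·β = 0, and (α+β)/2 ∉ U. Set M = U ∩ α^⊥ ∩ β^⊥. Then: (a) M has rank n and M♯/M has order 4, with the self-pairings mod ℤ of its three nonzero classes equal to 1/2, 1/2, 0 in some order; (b) the restriction map σ ↦ σ|_M is a group isomorphism from the stabilizer {σ ∈ O(U) : σ({α,β}) = {α,β}} of the unordered pair {α,β} onto O(M). -/
open Matrix

/-- Coordinatewise cast of an integer vector to a rational vector. -/
def castVec {n : ℕ} (x : Fin n → ℤ) : Fin n → ℚ := fun i => (x i : ℚ)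

/-- Dot product with a fixed vector, as a ℤ-linear map. -/
def dotL {n : ℕ} (c : Fin n → ℤ) : (Fin n → ℤ) →ₗ[ℤ] ℤ where
  toFun x := x ⬝ᵥ c
  map_add' x y := add_dotProduct x y c
  map_smul' r x := smul_dotProduct r x c

/-- The sublattice `{x ∈ ℤⁿ : x·v = 0}` of the lattice `ℤⁿ` with Gram matrix `P`. -/
def perpKer {n : ℕ} (P : Matrix (Fin n) (Fin n) ℤ) (v : Fin n → ℤ) :
    Submodule ℤ (Fin n → ℤ) :=
  LinearMap.ker (dotL (P *ᵥ v))

/-- The dual lattice `N♯ = {y ∈ N ⊗ ℚ : y·x ∈ ℤ for all x ∈ N}` of a sublattice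
`N ⊆ ℤⁿ`, for the form with (integer) Gram matrix `P`. -/
def latDualSet {n : ℕ} (P : Matrix (Fin n) (Fin n) ℤ) (N : Set (Fin n → ℤ)) :
    Set (Fin n → ℚ) :=
  {y | y ∈ Submodule.span ℚ (castVec '' N) ∧
    ∀ x ∈ N, ∃ k : ℤ, y ⬝ᵥ (P.map ((↑) : ℤ → ℚ)) *ᵥ castVec x = (k : ℚ)}

/-- `N♯/N` has order 4 and the self-pairings `x·x mod ℤ` of its three nonzero classes
are, in some order, `1/2`, `1/2` and `0`. -/
def ResidueHalfHalfZero {n : ℕ} (P : Matrix (Fin n) (Fin n) ℤ) (N : Set (Fin n → ℤ)) :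
    Prop :=
  ∃ y₁ ∈ latDualSet P N, ∃ y₂ ∈ latDualSet P N, ∃ y₃ ∈ latDualSet P N,
    y₁ ∉ castVec '' N ∧ y₂ ∉ castVec '' N ∧ y₃ ∉ castVec '' N ∧
    y₁ - y₂ ∉ castVec '' N ∧ y₁ - y₃ ∉ castVec '' N ∧ y₂ - y₃ ∉ castVec '' N ∧
    (∀ y ∈ latDualSet P N, y ∈ castVec '' N ∨ y - y₁ ∈ castVec '' N ∨
      y - y₂ ∈ castVec '' N ∨ y - y₃ ∈ castVec '' N) ∧
    (∃ k : ℤ, y₁ ⬝ᵥ (P.map ((↑) : ℤ → ℚ)) *ᵥ y₁ = (k : ℚ) + 1 / 2) ∧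
    (∃ k : ℤ, y₂ ⬝ᵥ (P.map ((↑) : ℤ → ℚ)) *ᵥ y₂ = (k : ℚ) + 1 / 2) ∧
    (∃ k : ℤ, y₃ ⬝ᵥ (P.map ((↑) : ℤ → ℚ)) *ᵥ y₃ = (k : ℚ))

/-- `σ` is an isometry of the lattice `ℤᵐ` with Gram matrix `P`. -/
def IsIsom {m : ℕ} (P : Matrix (Fin m) (Fin m) ℤ) (σ : (Fin m → ℤ) ≃ₗ[ℤ] (Fin m → ℤ)) :
    Prop :=
  ∀ x y : Fin m → ℤ, σ x ⬝ᵥ P *ᵥ σ y = x ⬝ᵥ P *ᵥ y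

/-- `σ` stabilizes the unordered pair `{α, β}`. -/
def StabPair {m : ℕ} (σ : (Fin m → ℤ) ≃ₗ[ℤ] (Fin m → ℤ)) (α β : Fin m → ℤ) : Prop :=
  (σ α = α ∧ σ β = β) ∨ (σ α = β ∧ σ β = α)


namespace OrthPair

structure Uni {V : Type*} [AddCommGroup V] (B : V →ₗ[ℤ] V →ₗ[ℤ] ℤ) : Prop where
  symm : ∀ x y, B x y = B y x
  rep : ∀ f : V →ₗ[ℤ] ℤ, ∃ u, ∀ x, B u x = f x
  nd : ∀ x, (∀ y, B x y = 0) → x = 0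

variable {V : Type*} [AddCommGroup V] {B : V →ₗ[ℤ] V →ₗ[ℤ] ℤ}

lemma Uni.ext (h : Uni B) {x y : V} (hxy : ∀ z, B x z = B y z) : x = y := by
  rw [← sub_eq_zero]
  apply h.nd
  intro z
  simp [hxy z]

lemma Uni.two (h : Uni B) {x y : V} (hxy : (2:ℤ) • x = (2:ℤ) • y) : x = y := by
  apply h.ext
  intro z
  have := congrArg (fun t => B t z) hxy
  simp at this
  exact this

lemma Uni.half (h : Uni B) (p : V) (hp : ∀ x, (2:ℤ) ∣ B p x) : ∃ z, p = (2:ℤ) • z := by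
  let f : V →ₗ[ℤ] ℤ :=
    { toFun := fun x => B p x / 2
      map_add' := by
        intro x y
        have h1 := hp x
        have h2 := hp y
        simp only [map_add]
        omega
      map_smul' := by
        intro r x
        simp only [map_smul, smul_eq_mul, eq_intCast, Int.cast_id]
        exact Int.mul_ediv_assoc r (hp x) }
  obtain ⟨z, hz⟩ := h.rep f
  refine ⟨z, h.ext fun x => ?_⟩
  have h1 : B z x = B p x / 2 := hz x
  have h2 := hp x
  simp only [map_smul, LinearMap.smul_apply, smul_eq_mul]
  omega

structure Dat (B : V →ₗ[ℤ] V →ₗ[ℤ] ℤ) (α β : V) : Prop where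
  uni : Uni B
  aa : B α α = 2
  bb : B β β = 2
  ab : B α β = 0
  half : ¬ ∃ z, α + β = (2:ℤ) • z

variable {α β : V}

lemma Dat.ba (h : Dat B α β) : B β α = 0 := by rw [h.uni.symm, h.ab]

lemma notHalf {α : V} (haa : B α α = 2) : ¬ ∃ z, α = (2:ℤ) • z := by
  rintro ⟨z, hz⟩
  rw [hz] at haa
  simp at haa
  omega

lemma Dat.half' (h : Dat B α β) : ¬ ∃ z, α - β = (2:ℤ) • z := by
  rintro ⟨z, hz⟩
  refine h.half ⟨z + β, ?_⟩
  rw [smul_add, ← hz]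
  module

lemma Dat.half'' (h : Dat B α β) : ¬ ∃ z, β - α = (2:ℤ) • z := by
  rintro ⟨z, hz⟩
  refine h.half ⟨z + α, ?_⟩
  rw [smul_add, ← hz]
  module

lemma Dat.adj (h : Dat B α β) (x : V) (e f : ℤ) (he : 2 ∣ B x α - e) (hf : 2 ∣ B x β - f) :
    ∃ u, B u α = e ∧ B u β = f := by
  obtain ⟨a, ha⟩ := he
  obtain ⟨b, hb⟩ := hf
  refine ⟨x - a • α - b • β, ?_, ?_⟩
  · simp [h.aa, h.ba]; linarith
  · simp [h.bb, h.ab]; linarith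

lemma Dat.exuv (h : Dat B α β) :
    (∃ u, B u α = 1 ∧ B u β = 0) ∧ (∃ v, B v α = 0 ∧ B v β = 1) := by
  have h1 : ∃ x, ¬ (2:ℤ) ∣ B α x := by
    by_contra hc; push Not at hc
    exact notHalf h.aa (h.uni.half α hc)
  have h2 : ∃ x, ¬ (2:ℤ) ∣ B β x := by
    by_contra hc; push Not at hc
    exact notHalf h.bb (h.uni.half β hc)
  have h3 : ∃ x, ¬ (2:ℤ) ∣ B (α + β) x := by
    by_contra hc; push Not at hc
    exact h.half (h.uni.half _ hc)
  obtain ⟨x, hx⟩ := h1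
  obtain ⟨y, hy⟩ := h2
  obtain ⟨z, hz⟩ := h3
  rw [h.uni.symm] at hx hy hz
  rw [map_add] at hz
  by_cases hza : (2:ℤ) ∣ B z α
  · constructor
    · by_cases hxb : (2:ℤ) ∣ B x β
      · exact h.adj x 1 0 (by omega) (by omega)
      · refine h.adj (x - z) 1 0 ?_ ?_ <;> simp only [map_sub, LinearMap.sub_apply] <;> omega
    · exact h.adj z 0 1 (by omega) (by omega)
  · constructor
    · exact h.adj z 1 0 (by omega) (by omega)
    · by_cases hxb : (2:ℤ) ∣ B y α
      · exact h.adj y 0 1 (by omega) (by omega)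
      · refine h.adj (y - z) 0 1 ?_ ?_ <;> simp only [map_sub, LinearMap.sub_apply] <;> omega

lemma Dat.inj (h : Dat B α β) (s t : V →ₗ[ℤ] V)
    (hs : (s α = α ∧ s β = β) ∨ (s α = β ∧ s β = α))
    (ht : (t α = α ∧ t β = β) ∨ (t α = β ∧ t β = α))
    (hst : ∀ x, B x α = 0 → B x β = 0 → s x = t x) (x : V) : s x = t x := by
  obtain ⟨⟨u, hu1, hu2⟩, -⟩ := h.exuv
  have e1 : s α = t α ∧ s β = t β := by
    have h1 := hst ((2:ℤ) • u - α) (by simp [hu1, h.aa]) (by simp [hu2, h.ab])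
    simp only [map_sub, map_smul] at h1
    have h2 : s α - t α = (2:ℤ) • (s u - t u) := by
      rw [smul_sub, ← sub_eq_zero]
      rw [← sub_eq_zero] at h1
      rw [← neg_eq_zero, ← h1]
      abel
    rcases hs with ⟨a, b⟩ | ⟨a, b⟩ <;> rcases ht with ⟨c, d⟩ | ⟨c, d⟩
    · simp [a, b, c, d]
    · rw [a, c] at h2; exact absurd ⟨_, h2⟩ h.half'
    · rw [a, c] at h2; exact absurd ⟨_, h2⟩ h.half''
    · simp [a, b, c, d]
  apply h.uni.two
  have h1 := hst ((2:ℤ) • x - B x α • α - B x β • β)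
    (by simp [h.aa, h.ba]; ring) (by simp [h.bb, h.ab]; ring)
  simp only [map_sub, map_smul, e1.1, e1.2] at h1
  simpa using h1

/-- residue class of an element `p` of `M` that lies in `2 M♯`. -/
lemma Dat.cls (h : Dat B α β) (p : V) (pa : B p α = 0) (pb : B p β = 0)
    (hp : ∀ m, B m α = 0 → B m β = 0 → (2:ℤ) ∣ B p m) (hn : (B p p) % 4 = 2) :
    (∃ z, p + α = (2:ℤ) • z) ∨ (∃ z, p + β = (2:ℤ) • z) := by
  obtain ⟨⟨u, hu1, hu2⟩, ⟨v, hv1, hv2⟩⟩ := h.exuv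
  have key : ∃ w, p - B p u • α - B p v • β = (2:ℤ) • w := by
    apply h.uni.half
    intro x
    have := hp (x - B x α • u - B x β • v) (by simp [hu1, hv1]) (by simp [hu2, hv2])
    simp only [map_sub, map_smul, LinearMap.sub_apply, LinearMap.smul_apply, smul_eq_mul] at this ⊢
    rw [h.uni.symm α x, h.uni.symm β x]
    convert this using 1
    ring
  obtain ⟨w, hw⟩ := key
  generalize B p u = e at hw
  generalize B p v = f at hw
  have hp2 : p = e • α + f • β + (2:ℤ) • w := by rw [← hw]; abel
  have wa : B w α = -e := by
    rw [hp2] at pa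
    simp [h.aa, h.ba] at pa
    linarith
  have wb : B w β = -f := by
    rw [hp2] at pb
    simp [h.bb, h.ab] at pb
    linarith
  have hpp : B p p = 4 * B w w - 2 * (e * e) - 2 * (f * f) := by
    rw [hp2]
    simp [h.aa, h.bb, h.ab, h.ba, wa, wb, h.uni.symm α w, h.uni.symm β w]
    ring
  rw [hpp] at hn
  rcases Int.even_or_odd' e with ⟨a, rfl | rfl⟩ <;> rcases Int.even_or_odd' f with ⟨b, rfl | rfl⟩
  · ring_nf at hn; omega
  · right; refine ⟨a • α + (b + 1) • β + w, ?_⟩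
    rw [hp2]; module
  · left; refine ⟨(a + 1) • α + b • β + w, ?_⟩
    rw [hp2]; module
  · ring_nf at hn; omega

lemma Dat.swap (h : Dat B α β) : Dat B β α :=
  ⟨h.uni, h.bb, h.aa, h.ba, by rw [add_comm]; exact h.half⟩

/-- extension, once the images of the discriminant classes are known -/
lemma Dat.extend (h : Dat B α β) (M : Submodule ℤ V)
    (hM : ∀ x, x ∈ M ↔ B x α = 0 ∧ B x β = 0) (g : M ≃ₗ[ℤ] M)
    (hg : ∀ x y : M, B (g x : V) (g y) = B x y) (α' β' : V)
    (h' : (α' = α ∧ β' = β) ∨ (α' = β ∧ β' = α))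
    (u v s t : V) (hu1 : B u α = 1) (hu2 : B u β = 0) (hv1 : B v α = 0) (hv2 : B v β = 1)
    (p q : M) (hp : (p : V) = (2:ℤ) • u - α) (hq : (q : V) = (2:ℤ) • v - β)
    (hs : (g p : V) + α' = (2:ℤ) • s) (ht : (g q : V) + β' = (2:ℤ) • t) :
    ∃ σ : V ≃ₗ[ℤ] V, (∀ x y, B (σ x) (σ y) = B x y) ∧ (σ α = α' ∧ σ β = β') ∧
      ∀ x : M, σ x = g x := by
  have hd : Dat B α' β' := by
    rcases h' with ⟨rfl, rfl⟩ | ⟨rfl, rfl⟩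
    · exact h
    · exact h.swap
  have hM' : ∀ x, x ∈ M ↔ B x α' = 0 ∧ B x β' = 0 := by
    intro x
    rcases h' with ⟨rfl, rfl⟩ | ⟨rfl, rfl⟩
    · exact hM x
    · rw [hM x, and_comm]
  let π : V →ₗ[ℤ] V := LinearMap.id - (B.flip α).smulRight u - (B.flip β).smulRight v
  have hπ : ∀ x, π x = x - B x α • u - B x β • v := fun x => by simp [π]
  let πM : V →ₗ[ℤ] M := π.codRestrict M (fun x => by
    rw [hM, hπ]; simp [hu1, hu2, hv1, hv2])
  have hπM : ∀ x, (πM x : V) = x - B x α • u - B x β • v := fun x => by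
    rw [← hπ]; rfl
  let σ : V →ₗ[ℤ] V := M.subtype ∘ₗ g.toLinearMap ∘ₗ πM
    + (B.flip α).smulRight s + (B.flip β).smulRight t
  have hσ : ∀ x, σ x = g (πM x) + B x α • s + B x β • t := fun x => by simp [σ]
  have key : ∀ (x : V) (m : M), (m : V) = (2:ℤ) • x - B x α • α - B x β • β →
      (2:ℤ) • σ x = g m + B x α • α' + B x β • β' := by
    intro x m hm
    have e : m = (2:ℤ) • πM x + B x α • p + B x β • q := by
      apply Subtype.ext
      push_cast
      rw [hm, hπM, hp, hq]
      module
    rw [hσ, e]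
    simp only [map_add, map_smul]
    push_cast
    have e1 : (2:ℤ) • (B x α • s) = B x α • ((g p : V) + α') := by rw [hs]; module
    have e2 : (2:ℤ) • (B x β • t) = B x β • ((g q : V) + β') := by rw [ht]; module
    rw [smul_add, smul_add, e1, e2]
    module
  have hm : ∀ x : V, ∃ m : M, (m : V) = (2:ℤ) • x - B x α • α - B x β • β := by
    intro x
    refine ⟨⟨_, (hM _).2 ⟨?_, ?_⟩⟩, rfl⟩
    · simp [h.aa, h.ba]; ring
    · simp [h.bb, h.ab]; ring
  have iso : ∀ x y, B (σ x) (σ y) = B x y := by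
    intro x y
    obtain ⟨m, em⟩ := hm x
    obtain ⟨k, ek⟩ := hm y
    have h1 := key x m em
    have h2 := key y k ek
    have h3 : B ((2:ℤ) • σ x) ((2:ℤ) • σ y) = 4 * B (σ x) (σ y) := by simp; ring
    obtain ⟨ma, mb⟩ := (hM' _).1 (g m).2
    obtain ⟨ka, kb⟩ := (hM' _).1 (g k).2
    have h4 : B (g m : V) (g k) = B (m : V) k := hg m k
    rw [h1, h2] at h3
    simp only [map_add, map_smul, LinearMap.add_apply, LinearMap.smul_apply, smul_eq_mul, ma, mb,
      hd.uni.symm α' (g k), hd.uni.symm β' (g k), ka, kb, hd.aa, hd.bb, hd.ab, hd.ba, h4] at h3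
    rw [em, ek] at h3
    simp only [map_sub, map_smul, LinearMap.sub_apply, LinearMap.smul_apply, smul_eq_mul,
      h.uni.symm α y, h.uni.symm β y, h.aa, h.bb, h.ab, h.ba] at h3
    linarith
  have sα : σ α = α' := by
    apply h.uni.two
    rw [key α 0 (by simp [h.aa, h.ab])]
    simp [h.aa, h.ab]
  have sβ : σ β = β' := by
    apply h.uni.two
    rw [key β 0 (by simp [h.bb, h.ba])]
    simp [h.bb, h.ba]
  have sM : ∀ x : M, σ x = g x := by
    intro x
    obtain ⟨a, b⟩ := (hM _).1 x.2
    have : πM x = x := by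
      apply Subtype.ext
      rw [hπM, a, b]; simp
    rw [hσ, this, a, b]; simp
  have surj2 : ∀ y, ∃ x, σ x = (2:ℤ) • y := by
    intro y
    have hk : (2:ℤ) • y - B y α' • α' - B y β' • β' ∈ M := by
      rw [hM']
      constructor
      · simp [hd.aa, hd.ba]; ring
      · simp [hd.bb, hd.ab]; ring
    refine ⟨(g.symm ⟨_, hk⟩ : V) + B y α' • α + B y β' • β, ?_⟩
    rw [map_add, map_add, map_smul, map_smul, sM, sα, sβ]
    simp only [LinearEquiv.apply_symm_apply]
    abel
  have inj : Function.Injective σ := by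
    intro x y hxy
    apply h.uni.ext
    intro z
    rw [← iso x z, hxy, iso]
  have surj : Function.Surjective σ := by
    intro y
    obtain ⟨w, hw⟩ := h.uni.rep ((B y) ∘ₗ σ)
    refine ⟨w, h.uni.ext fun z => ?_⟩
    obtain ⟨x, hx⟩ := surj2 z
    have h1 : B (σ w) (σ x) = B y (σ x) := by rw [iso, hw]; rfl
    rw [hx] at h1
    simpa using h1
  exact ⟨LinearEquiv.ofBijective σ ⟨inj, surj⟩, iso, ⟨sα, sβ⟩, sM⟩

lemma Dat.surj (h : Dat B α β) (M : Submodule ℤ V)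
    (hM : ∀ x, x ∈ M ↔ B x α = 0 ∧ B x β = 0) (g : M ≃ₗ[ℤ] M)
    (hg : ∀ x y : M, B (g x : V) (g y) = B x y) :
    ∃ σ : V ≃ₗ[ℤ] V, (∀ x y, B (σ x) (σ y) = B x y) ∧
      ((σ α = α ∧ σ β = β) ∨ (σ α = β ∧ σ β = α)) ∧ ∀ x : M, σ x = g x := by
  obtain ⟨⟨u, hu1, hu2⟩, ⟨v, hv1, hv2⟩⟩ := h.exuv
  have hpM : (2:ℤ) • u - α ∈ M := by
    rw [hM]; simp [hu1, hu2, h.aa, h.ab]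
  have hqM : (2:ℤ) • v - β ∈ M := by
    rw [hM]; simp [hv1, hv2, h.bb, h.ba]
  obtain ⟨p, hp⟩ : ∃ p : M, (p : V) = (2:ℤ) • u - α := ⟨⟨_, hpM⟩, rfl⟩
  obtain ⟨q, hq⟩ : ∃ q : M, (q : V) = (2:ℤ) • v - β := ⟨⟨_, hqM⟩, rfl⟩
  obtain ⟨pa, pb⟩ := (hM _).1 (g p).2
  obtain ⟨qa, qb⟩ := (hM _).1 (g q).2
  have cp := h.cls (g p) pa pb (by
    intro m ma mb
    obtain ⟨k, hk⟩ := g.surjective ⟨m, (hM m).2 ⟨ma, mb⟩⟩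
    have : m = (g k : V) := by rw [hk]
    obtain ⟨ka, kb⟩ := (hM _).1 k.2
    rw [this, hg, hp]
    simp [h.uni.symm α k, ka]) (by
    rw [hg, hp]
    simp [h.aa, hu1, h.uni.symm α u]
    omega)
  have cq := h.cls (g q) qa qb (by
    intro m ma mb
    obtain ⟨k, hk⟩ := g.surjective ⟨m, (hM m).2 ⟨ma, mb⟩⟩
    have : m = (g k : V) := by rw [hk]
    obtain ⟨ka, kb⟩ := (hM _).1 k.2
    rw [this, hg, hq]
    simp [h.uni.symm β k, kb]) (by
    rw [hg, hq]
    simp [h.bb, hv2, h.uni.symm β v]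
    omega)
  have no : ∀ w, (g p : V) - g q ≠ (2:ℤ) • w := by
    intro w hw
    have hwM : w ∈ M := by
      have h1 : (2:ℤ) • w ∈ M := by rw [← hw]; exact M.sub_mem (g p).2 (g q).2
      rw [hM] at h1 ⊢
      simpa using h1
    obtain ⟨k, hk⟩ := g.surjective ⟨w, hwM⟩
    have h2 : p - q = (2:ℤ) • k := by
      apply g.injective
      rw [map_sub, map_smul, hk]
      apply Subtype.ext
      push_cast
      exact hw
    have h3 := congrArg (Subtype.val) h2
    push_cast at h3
    rw [hp, hq] at h3
    refine h.half'' ⟨(k : V) - u + v, ?_⟩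
    rw [smul_add, smul_sub, ← h3]
    abel
  rcases cp with ⟨s, hs⟩ | ⟨s, hs⟩ <;> rcases cq with ⟨t, ht⟩ | ⟨t, ht⟩
  · exfalso; apply no (s - t); rw [smul_sub, ← hs, ← ht]; abel
  · obtain ⟨σ, a, b, c⟩ := h.extend M hM g hg α β (Or.inl ⟨rfl, rfl⟩) u v s t hu1 hu2 hv1 hv2 p q
      hp hq hs ht
    exact ⟨σ, a, Or.inl b, c⟩
  · obtain ⟨σ, a, b, c⟩ := h.extend M hM g hg β α (Or.inr ⟨rfl, rfl⟩) u v s t hu1 hu2 hv1 hv2 p q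
      hp hq hs ht
    exact ⟨σ, a, Or.inr b, c⟩
  · exfalso; apply no (s - t); rw [smul_sub, ← hs, ← ht]; abel

end OrthPair

namespace OrthPair

section rat
variable {m : ℕ} (P : Matrix (Fin m) (Fin m) ℤ)

lemma cv_sub (x y : Fin m → ℤ) : castVec (x - y) = castVec x - castVec y := by
  ext i; simp [castVec]

lemma cv_smul (r : ℤ) (x : Fin m → ℤ) : castVec (r • x) = (r : ℚ) • castVec x := by
  ext i; simp [castVec]

lemma cv_inj {x y : Fin m → ℤ} (h : castVec x = castVec y) : x = y := by
  ext i
  have := congrFun h i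
  simpa [castVec] using this

/-- the integral form -/
noncomputable def BZ : (Fin m → ℤ) →ₗ[ℤ] (Fin m → ℤ) →ₗ[ℤ] ℤ := Matrix.toBilin' P

/-- the rational form -/
noncomputable def BQ : (Fin m → ℚ) →ₗ[ℚ] (Fin m → ℚ) →ₗ[ℚ] ℚ :=
  Matrix.toBilin' (P.map ((↑) : ℤ → ℚ))

lemma BZ_apply (x y : Fin m → ℤ) : BZ P x y = x ⬝ᵥ P *ᵥ y := Matrix.toBilin'_apply' P x y

lemma BQ_apply (x y : Fin m → ℚ) : BQ P x y = x ⬝ᵥ (P.map ((↑) : ℤ → ℚ)) *ᵥ y :=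
  Matrix.toBilin'_apply' _ x y

lemma BQ_cast (x y : Fin m → ℤ) : BQ P (castVec x) (castVec y) = (BZ P x y : ℚ) := by
  rw [BQ_apply, BZ_apply]
  simp [dotProduct, mulVec, castVec]

variable {P}

lemma BZ_symm (hs : P.IsSymm) (x y : Fin m → ℤ) : BZ P x y = BZ P y x := by
  rw [BZ_apply, BZ_apply, dotProduct_comm, ← vecMul_transpose, hs.eq, dotProduct_mulVec]

lemma BQ_symm (hs : P.IsSymm) (x y : Fin m → ℚ) : BQ P x y = BQ P y x := by
  have hs' : (P.map ((↑) : ℤ → ℚ)).IsSymm := hs.map _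
  rw [BQ_apply, BQ_apply, dotProduct_comm, ← vecMul_transpose, hs'.eq, dotProduct_mulVec]

lemma uniBZ (hs : P.IsSymm) (hpos : ∀ x : Fin m → ℤ, x ≠ 0 → 0 < x ⬝ᵥ P *ᵥ x)
    (hdet : P.det = 1) : Uni (BZ P) where
  symm := BZ_symm hs
  rep := by
    intro f
    refine ⟨P⁻¹ *ᵥ (fun i => f (Pi.single i 1)), fun x => ?_⟩
    rw [BZ_symm hs, BZ_apply, mulVec_mulVec, Matrix.mul_nonsing_inv _ (by rw [hdet]; exact isUnit_one),
      one_mulVec, LinearMap.pi_apply_eq_sum_univ f x]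
    simp only [dotProduct, smul_eq_mul]
    refine Finset.sum_congr rfl fun i _ => ?_
    congr 2
    ext j
    simp [Pi.single_apply, eq_comm]
  nd := by
    intro x hx
    by_contra hc
    have := hpos x hc
    rw [← BZ_apply, hx] at this
    exact lt_irrefl _ this

lemma BQ_nd (hdet : P.det = 1) (y : Fin m → ℚ) (h : ∀ x, BQ P y (castVec x) = 0) : y = 0 := by
  apply Matrix.eq_zero_of_vecMul_eq_zero (M := P.map ((↑) : ℤ → ℚ))
  · have : (P.map ((↑) : ℤ → ℚ)).det = ((P.det : ℤ) : ℚ) :=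
      ((Int.castRingHom ℚ).map_det P).symm
    rw [this, hdet]; simp
  · ext i
    have := h (Pi.single i 1)
    rw [BQ_apply, dotProduct_mulVec] at this
    have e : castVec (Pi.single i 1 : Fin m → ℤ) = Pi.single i 1 := by
      ext j; simp only [castVec, Pi.single_apply]; split_ifs <;> simp
    rw [e, dotProduct_single_one] at this
    exact this

variable (P) in
/-- projection of `w` to the rational span of `M` -/
noncomputable def yv (α β w : Fin m → ℤ) : Fin m → ℚ :=
  castVec w - ((BZ P w α : ℚ) / 2) • castVec α - ((BZ P w β : ℚ) / 2) • castVec β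

variable {α β : Fin m → ℤ}

lemma yv_sub (w w' : Fin m → ℤ) : yv P α β w - yv P α β w' = yv P α β (w - w') := by
  simp only [yv, cv_sub, map_sub, LinearMap.sub_apply, Int.cast_sub]
  module

lemma yv_half {w z : Fin m → ℤ} (h : yv P α β w = castVec z) :
    BZ P w α • α + BZ P w β • β = (2:ℤ) • (w - z) := by
  apply cv_inj
  rw [cv_smul, cv_sub, ← h, yv]
  have e : castVec (BZ P w α • α + BZ P w β • β) =
    (BZ P w α : ℚ) • castVec α + (BZ P w β : ℚ) • castVec β := by
    ext i; simp [castVec]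
  rw [e]
  push_cast
  module

lemma mem_perp (x : Fin m → ℤ) :
    x ∈ perpKer P α ⊓ perpKer P β ↔ BZ P x α = 0 ∧ BZ P x β = 0 := by
  rw [BZ_apply, BZ_apply]; rfl

lemma yv_even (h : Dat (BZ P) α β) (w : Fin m → ℤ) (a b : ℤ)
    (ha : BZ P w α = 2 * a) (hb : BZ P w β = 2 * b) :
    yv P α β w ∈ castVec '' ((perpKer P α ⊓ perpKer P β : Submodule ℤ (Fin m → ℤ)) :
          Set (Fin m → ℤ)) := by
  refine ⟨w - a • α - b • β, (mem_perp _).2 ⟨?_, ?_⟩, ?_⟩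
  · simp [-zsmul_eq_mul, h.aa, h.ba, ha]; ring
  · simp [-zsmul_eq_mul, h.bb, h.ab, hb]; ring
  · rw [yv, ha, hb, cv_sub, cv_sub, cv_smul, cv_smul]
    push_cast
    module

lemma yv_mem (h : Dat (BZ P) α β) (w : Fin m → ℤ) :
    yv P α β w ∈ latDualSet P ((perpKer P α ⊓ perpKer P β : Submodule ℤ (Fin m → ℤ)) :
          Set (Fin m → ℤ)) := by
  constructor
  · have : yv P α β w = (1/2 : ℚ) •
        castVec ((2:ℤ) • w - BZ P w α • α - BZ P w β • β) := by
      rw [cv_sub, cv_sub, cv_smul, cv_smul, cv_smul, yv]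
      push_cast
      module
    rw [this]
    apply Submodule.smul_mem
    apply Submodule.subset_span
    refine ⟨_, (mem_perp _).2 ⟨?_, ?_⟩, rfl⟩
    · simp [-zsmul_eq_mul, h.aa, h.ba]; ring
    · simp [-zsmul_eq_mul, h.bb, h.ab]; ring
  · intro x hx
    obtain ⟨xa, xb⟩ := (mem_perp x).1 hx
    refine ⟨BZ P w x, ?_⟩
    rw [← BQ_apply, yv]
    simp [BQ_cast, h.uni.symm α x, h.uni.symm β x, xa, xb]

lemma yv_norm (h : Dat (BZ P) α β) (w : Fin m → ℤ) :
    yv P α β w ⬝ᵥ (P.map ((↑) : ℤ → ℚ)) *ᵥ yv P α β w =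
      (BZ P w w : ℚ) - (BZ P w α : ℚ) ^ 2 / 2 - (BZ P w β : ℚ) ^ 2 / 2 := by
  rw [← BQ_apply, yv]
  simp [BQ_cast, h.uni.symm α w, h.uni.symm β w, h.aa, h.bb, h.ab, h.ba]
  ring

lemma yv_surj (hs : P.IsSymm) (hdet : P.det = 1) (h : Dat (BZ P) α β) (y : Fin m → ℚ)
    (hy : y ∈ latDualSet P ((perpKer P α ⊓ perpKer P β : Submodule ℤ (Fin m → ℤ)) :
          Set (Fin m → ℤ))) : ∃ w, y = yv P α β w := by
  obtain ⟨hspan, hint⟩ := hy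
  obtain ⟨⟨u, hu1, hu2⟩, ⟨v, hv1, hv2⟩⟩ := h.exuv
  have hperp : BQ P y (castVec α) = 0 ∧ BQ P y (castVec β) = 0 := by
    have key : ∀ γ : Fin m → ℤ, (∀ x ∈ perpKer P α ⊓ perpKer P β, BZ P x γ = 0) →
        BQ P y (castVec γ) = 0 := by
      intro γ hγ
      have : Submodule.span ℚ (castVec '' ((perpKer P α ⊓ perpKer P β :
          Submodule ℤ (Fin m → ℤ)) : Set (Fin m → ℤ))) ≤
          LinearMap.ker ((BQ P).flip (castVec γ)) := by
        rw [Submodule.span_le]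
        rintro _ ⟨z, hz, rfl⟩
        simp [BQ_cast, hγ z hz]
      simpa using this hspan
    exact ⟨key α fun x hx => ((mem_perp x).1 hx).1, key β fun x hx => ((mem_perp x).1 hx).2⟩
  obtain ⟨ya, yb⟩ := hperp
  have hin : ∀ x : Fin m → ℤ, ∃ k : ℤ,
      BQ P y (castVec (x - BZ P x α • u - BZ P x β • v)) = k := by
    intro x
    obtain ⟨k, hk⟩ := hint (x - BZ P x α • u - BZ P x β • v)
      ((mem_perp _).2 ⟨by simp [-zsmul_eq_mul, hu1, hv1], by simp [-zsmul_eq_mul, hu2, hv2]⟩)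
    exact ⟨k, by rw [BQ_apply, hk]⟩
  choose f hf using hin
  let F : (Fin m → ℤ) →ₗ[ℤ] ℤ :=
    { toFun := f
      map_add' := by
        intro x x'
        have : ((f (x + x') : ℤ) : ℚ) = ((f x + f x' : ℤ) : ℚ) := by
          push_cast
          rw [← hf, ← hf, ← hf, ← map_add]
          congr 1
          ext i; simp [castVec]; ring
        exact_mod_cast this
      map_smul' := by
        intro r x
        have : ((f (r • x) : ℤ) : ℚ) = ((r * f x : ℤ) : ℚ) := by
          push_cast
          rw [← hf, ← hf, ← smul_eq_mul, ← map_smul]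
          congr 1
          ext i; simp [-zsmul_eq_mul, castVec]; ring
        simp only [eq_intCast, Int.cast_id, smul_eq_mul]
        exact_mod_cast this }
  obtain ⟨w, hw⟩ := h.uni.rep F
  have hw' : ∀ x, (BZ P w x : ℚ) = BQ P y (castVec x) - (BZ P x α : ℚ) * BQ P y (castVec u)
      - (BZ P x β : ℚ) * BQ P y (castVec v) := by
    intro x
    rw [hw x]
    change ((f x : ℤ) : ℚ) = _
    rw [← hf, cv_sub, cv_sub, cv_smul, cv_smul]
    simp
  have wa := hw' α
  have wb := hw' β
  rw [h.aa, h.ab, ya] at wa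
  rw [h.ba, h.bb, yb] at wb
  push_cast at wa wb
  refine ⟨w, ?_⟩
  rw [← sub_eq_zero]
  apply BQ_nd hdet
  intro x
  rw [yv, map_sub, map_sub, map_sub]
  simp only [LinearMap.sub_apply, map_smul, LinearMap.smul_apply, smul_eq_mul, BQ_cast, hw' x, wa,
    wb, h.uni.symm α x, h.uni.symm β x]
  ring

lemma residue (hs : P.IsSymm) (hdet : P.det = 1) (h : Dat (BZ P) α β) :
    ResidueHalfHalfZero P ((perpKer P α ⊓ perpKer P β : Submodule ℤ (Fin m → ℤ)) :
          Set (Fin m → ℤ)) := by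
  obtain ⟨⟨u, hu1, hu2⟩, ⟨v, hv1, hv2⟩⟩ := h.exuv
  have nn : ∀ w, (¬ ∃ z, BZ P w α • α + BZ P w β • β = (2:ℤ) • z) → yv P α β w ∉
      castVec '' ((perpKer P α ⊓ perpKer P β : Submodule ℤ (Fin m → ℤ)) : Set (Fin m → ℤ)) := by
    rintro w hw ⟨z, -, hz⟩
    exact hw ⟨_, yv_half hz.symm⟩
  have na := notHalf h.aa
  have nb := notHalf h.bb
  refine ⟨_, yv_mem h u, _, yv_mem h v, _, yv_mem h (u + v), nn _ ?_, nn _ ?_, nn _ ?_, ?_, ?_, ?_,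
    ?_, ?_, ?_, ?_⟩
  · simpa [hu1, hu2] using na
  · simpa [hv1, hv2] using nb
  · simpa [hu1, hu2, hv1, hv2] using h.half
  · rw [yv_sub]; apply nn
    simpa [hu1, hu2, hv1, hv2, sub_eq_add_neg] using h.half'
  · rw [yv_sub]; apply nn
    rintro ⟨z, hz⟩
    refine nb ⟨-z, ?_⟩
    rw [smul_neg, ← hz]
    simp [hu1, hu2, hv1, hv2]
  · rw [yv_sub]; apply nn
    rintro ⟨z, hz⟩
    refine na ⟨-z, ?_⟩
    rw [smul_neg, ← hz]
    simp [hu1, hu2, hv1, hv2]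
  · intro y hy
    obtain ⟨w, rfl⟩ := yv_surj hs hdet h y hy
    rw [yv_sub, yv_sub, yv_sub]
    rcases Int.even_or_odd' (BZ P w α) with ⟨a, ha | ha⟩ <;>
      rcases Int.even_or_odd' (BZ P w β) with ⟨b, hb | hb⟩
    · exact Or.inl (yv_even h w a b ha hb)
    · exact Or.inr (Or.inr (Or.inl (yv_even h _ a b (by simp [ha, hv1]) (by simp [hb, hv2]))))
    · exact Or.inr (Or.inl (yv_even h _ a b (by simp [ha, hu1]) (by simp [hb, hu2])))
    · exact Or.inr (Or.inr (Or.inr (yv_even h _ a b (by simp [ha, hu1, hv1])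
        (by simp [hb, hu2, hv2]))))
  · refine ⟨BZ P u u - 1, ?_⟩
    rw [yv_norm h, hu1, hu2]; push_cast; ring
  · refine ⟨BZ P v v - 1, ?_⟩
    rw [yv_norm h, hv1, hv2]; push_cast; ring
  · refine ⟨BZ P (u + v) (u + v) - 1, ?_⟩
    have e1 : BZ P (u + v) α = 1 := by simp [hu1, hv1]
    have e2 : BZ P (u + v) β = 1 := by simp [hu2, hv2]
    rw [yv_norm h, e1, e2]; push_cast; ring

end rat

lemma rank_eq {n : ℕ} {P : Matrix (Fin (n + 2)) (Fin (n + 2)) ℤ} {α β : Fin (n + 2) → ℤ}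
    (h : Dat (BZ P) α β) :
    Module.finrank ℤ (perpKer P α ⊓ perpKer P β : Submodule ℤ (Fin (n + 2) → ℤ)) = n := by
  obtain ⟨⟨u, hu1, hu2⟩, ⟨v, hv1, hv2⟩⟩ := h.exuv
  rw [BZ_apply] at hu1 hu2 hv1 hv2
  let f := (dotL (P *ᵥ α)).prod (dotL (P *ᵥ β))
  have hk : perpKer P α ⊓ perpKer P β = LinearMap.ker f := (LinearMap.ker_prod _ _).symm
  have hr : LinearMap.range f = ⊤ := by
    rw [LinearMap.range_eq_top]
    rintro ⟨a, b⟩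
    have fu : f u = (1, 0) := Prod.ext hu1 hu2
    have fv : f v = (0, 1) := Prod.ext hv1 hv2
    refine ⟨a • u + b • v, ?_⟩
    rw [map_add, map_smul, map_smul, fu, fv]
    simp
  have h1 := Submodule.finrank_quotient_add_finrank (LinearMap.ker f)
  rw [f.quotKerEquivRange.finrank_eq] at h1
  have := h1
  rw [hr, finrank_top, Module.finrank_prod, Module.finrank_self, Module.finrank_fin_fun] at this
  rw [hk]
  omega

end OrthPair

/-- Let `U = ℤ^{n+2}` (Gram matrix `P`) be a unimodular lattice, `α, β` orthogonal roots
with `(α+β)/2 ∉ U`, and `M = U ∩ α^⊥ ∩ β^⊥`. Then (a) `M` has rank `n` and `M♯/M` has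
order 4 with self-pairings `1/2, 1/2, 0`; (b) restriction to `M` is a group isomorphism
from the stabilizer of `{α, β}` in `O(U)` onto `O(M)`. -/
theorem orthogonal_of_pair_of_orthogonal_roots
    {n : ℕ} (P : Matrix (Fin (n + 2)) (Fin (n + 2)) ℤ)
    (hsymm : P.IsSymm) (hpos : ∀ x : Fin (n + 2) → ℤ, x ≠ 0 → 0 < x ⬝ᵥ P *ᵥ x)
    (hdet : P.det = 1) (α β : Fin (n + 2) → ℤ)
    (hα : α ⬝ᵥ P *ᵥ α = 2) (hβ : β ⬝ᵥ P *ᵥ β = 2) (hαβ : α ⬝ᵥ P *ᵥ β = 0)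
    (hhalf : ¬ ∃ z : Fin (n + 2) → ℤ, α + β = 2 • z) :
    (Module.finrank ℤ (perpKer P α ⊓ perpKer P β : Submodule ℤ (Fin (n + 2) → ℤ)) = n ∧
      ResidueHalfHalfZero P
        ((perpKer P α ⊓ perpKer P β : Submodule ℤ (Fin (n + 2) → ℤ)) :
          Set (Fin (n + 2) → ℤ))) ∧
    ((∀ σ : (Fin (n + 2) → ℤ) ≃ₗ[ℤ] (Fin (n + 2) → ℤ), IsIsom P σ → StabPair σ α β →
        Submodule.map σ.toLinearMap (perpKer P α ⊓ perpKer P β)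
          = perpKer P α ⊓ perpKer P β) ∧
      (∀ σ₁ σ₂ : (Fin (n + 2) → ℤ) ≃ₗ[ℤ] (Fin (n + 2) → ℤ),
        IsIsom P σ₁ → StabPair σ₁ α β → IsIsom P σ₂ → StabPair σ₂ α β →
        (∀ x ∈ perpKer P α ⊓ perpKer P β, σ₁ x = σ₂ x) → σ₁ = σ₂) ∧
      (∀ g : (perpKer P α ⊓ perpKer P β : Submodule ℤ (Fin (n + 2) → ℤ)) ≃ₗ[ℤ]
          (perpKer P α ⊓ perpKer P β : Submodule ℤ (Fin (n + 2) → ℤ)),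
        (∀ x y : (perpKer P α ⊓ perpKer P β : Submodule ℤ (Fin (n + 2) → ℤ)),
          (g x : Fin (n + 2) → ℤ) ⬝ᵥ P *ᵥ (g y : Fin (n + 2) → ℤ)
            = (x : Fin (n + 2) → ℤ) ⬝ᵥ P *ᵥ (y : Fin (n + 2) → ℤ)) →
        ∃ σ : (Fin (n + 2) → ℤ) ≃ₗ[ℤ] (Fin (n + 2) → ℤ), IsIsom P σ ∧ StabPair σ α β ∧
          ∀ x : (perpKer P α ⊓ perpKer P β : Submodule ℤ (Fin (n + 2) → ℤ)),
            σ (x : Fin (n + 2) → ℤ) = ((g x : _) : Fin (n + 2) → ℤ))) := by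
  have hd : OrthPair.Dat (OrthPair.BZ P) α β := by
    refine ⟨OrthPair.uniBZ hsymm hpos hdet, ?_, ?_, ?_, ?_⟩
    · rw [OrthPair.BZ_apply, hα]
    · rw [OrthPair.BZ_apply, hβ]
    · rw [OrthPair.BZ_apply, hαβ]
    · rintro ⟨z, hz⟩
      refine hhalf ⟨z, ?_⟩
      rw [hz]
      module
  refine ⟨⟨OrthPair.rank_eq hd, OrthPair.residue hsymm hdet hd⟩, ?_, ?_, ?_⟩
  · intro σ hσ hst
    have hσ' : ∀ x y, OrthPair.BZ P (σ x) (σ y) = OrthPair.BZ P x y := by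
      intro x y; rw [OrthPair.BZ_apply, OrthPair.BZ_apply]; exact hσ x y
    have hmem : ∀ x, σ x ∈ perpKer P α ⊓ perpKer P β ↔ x ∈ perpKer P α ⊓ perpKer P β := by
      intro x
      rw [OrthPair.mem_perp, OrthPair.mem_perp]
      have h1 := hσ' x α
      have h2 := hσ' x β
      rcases hst with ⟨a, b⟩ | ⟨a, b⟩
      · rw [a] at h1; rw [b] at h2; rw [h1, h2]
      · rw [a] at h1; rw [b] at h2; rw [h1, h2, and_comm]
    ext y
    constructor
    · rintro ⟨x, hx, rfl⟩
      exact (hmem x).2 hx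
    · intro hy
      refine ⟨σ.symm y, (hmem _).1 (by simpa using hy), by simp⟩
  · intro σ₁ σ₂ _ h1 _ h2 h
    ext1 x
    exact hd.inj σ₁.toLinearMap σ₂.toLinearMap h1 h2
      (fun x ha hb => h x ((OrthPair.mem_perp x).2 ⟨ha, hb⟩)) x
  · intro g hg
    obtain ⟨σ, h1, h2, h3⟩ := hd.surj _ OrthPair.mem_perp g (by
      intro x y; rw [OrthPair.BZ_apply, OrthPair.BZ_apply]; exact hg x y)
    refine ⟨σ, ?_, h2, h3⟩
    intro x y
    rw [← OrthPair.BZ_apply, ← OrthPair.BZ_apply]; exact h1 x y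
end

section
/- Let L be an exceptional unimodular integral lattice of rank n with n ≢ 6 and n ≢ 7 (mod 8). Then O(L) acts transitively on Exc L: for any two characteristic vectors v, v′ of L with v·v < 8 and v′·v′ < 8, there exists σ ∈ O(L) with σ(v) = v′. -/
open Matrix
open Filter Topology in
lemma theta_L1 (c τ : ℂ) (hτ : 0 < τ.im) :
    HasSum (fun n : ℤ => Complex.exp (Real.pi * Complex.I * ((n:ℂ) + c)^2 * τ))
      (1 / (-Complex.I * τ)^(1/2 : ℂ) * jacobiTheta₂ c (-1/τ)) := by
  have h := hasSum_jacobiTheta₂_term (c * τ) hτ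
  have hτ0 : τ ≠ 0 := by rintro rfl; simp at hτ
  have h2 := h.mul_left (Complex.exp (Real.pi * Complex.I * c^2 * τ))
  have hf : (fun n : ℤ => Complex.exp (Real.pi * Complex.I * ((n:ℂ) + c)^2 * τ)) =
      fun n : ℤ => Complex.exp (Real.pi * Complex.I * c^2 * τ) * jacobiTheta₂_term n (c * τ) τ := by
    ext n
    rw [jacobiTheta₂_term, ← Complex.exp_add]
    congr 1
    ring
  rw [hf]
  refine (congrArg (HasSum _) ?_).mpr h2
  · rw [jacobiTheta₂_functional_equation (c * τ) τ]
    have : c * τ / τ = c := by field_simp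
    rw [this]
    have e : Complex.exp (Real.pi * Complex.I * c^2 * τ) * Complex.exp (-Real.pi * Complex.I * (c * τ)^2 / τ) = 1 := by
      rw [← Complex.exp_add, ← Complex.exp_zero]
      congr 1
      field_simp
      ring
    linear_combination (-(1 / (-Complex.I * τ)^(1/2 : ℂ) * jacobiTheta₂ c (-1/τ))) * e

open Filter Topology in
lemma theta_L2 {ι : Type*} {l : Filter ι} (c : ℝ) (τ : ι → ℂ) (h : Tendsto (fun i => (τ i).im) l atTop) :
    Tendsto (fun i => jacobiTheta₂ c (τ i)) l (𝓝 1) := by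
  have key : Tendsto (fun i => ∑' n : ℤ, jacobiTheta₂_term n c (τ i)) l
      (𝓝 (∑' n : ℤ, if n = 0 then (1:ℂ) else 0)) := by
    have hs : Summable (fun n : ℤ => ‖jacobiTheta₂_term n 0 Complex.I‖) :=
      ((summable_jacobiTheta₂_term_iff 0 Complex.I).2 (by simp)).norm
    refine tendsto_tsum_of_dominated_convergence hs ?_ ?_
    · intro n
      by_cases hn : n = 0
      · simpa [hn, jacobiTheta₂_term] using tendsto_const_nhds
      · simp only [hn, if_false]
        rw [tendsto_zero_iff_norm_tendsto_zero]
        simp only [norm_jacobiTheta₂_term]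
        have hn2 : 0 < Real.pi * (n:ℝ)^2 := by positivity
        simp only [Complex.ofReal_im, mul_zero, sub_zero]
        refine Real.tendsto_exp_atBot.comp ?_
        have := (h.const_mul_atTop hn2)
        have := tendsto_neg_atTop_atBot.comp this
        refine this.congr ?_
        intro i; simp
    · filter_upwards [h.eventually_ge_atTop 1] with i hi n
      rw [norm_jacobiTheta₂_term, norm_jacobiTheta₂_term]
      simp only [Complex.ofReal_im, mul_zero, sub_zero, Complex.zero_im, Complex.I_im, mul_one]
      apply Real.exp_le_exp.2
      have hn2 : 0 ≤ Real.pi * (n:ℝ)^2 := by positivity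
      nlinarith
  simpa [jacobiTheta₂] using key

open Filter Topology in
lemma theta_L3 (N : ℕ) (hN : 0 < N) (r : ℝ) :
    Tendsto (fun ε : ℝ => (Real.sqrt ε : ℂ) * ∑' m : ℤ, Complex.exp (-Real.pi * ε * ((N:ℂ) * m + r)^2))
      (𝓝[>] 0) (𝓝 (1 / N)) := by
  have hN' : (N:ℂ) ≠ 0 := by exact_mod_cast hN.ne'
  have hNr : (0:ℝ) < N := by exact_mod_cast hN
  have h2 : Tendsto (fun ε : ℝ => jacobiTheta₂ ((r / N : ℝ):ℂ) (-1/(Complex.I * ((N:ℝ)^2 * ε : ℝ)))) (𝓝[>] 0) (𝓝 1) := by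
    apply theta_L2
    have h3 : Tendsto (fun ε : ℝ => (1/(N:ℝ)^2) * ε⁻¹) (𝓝[>] 0) atTop :=
      tendsto_inv_nhdsGT_zero.const_mul_atTop (by positivity)
    refine h3.congr' ?_
    filter_upwards [self_mem_nhdsWithin] with ε hε
    have hε : 0 < ε := hε
    have : (-1/(Complex.I * ((N:ℝ)^2 * ε : ℝ))) = Complex.I * ((1/((N:ℝ)^2 * ε) : ℝ) : ℂ) := by
      have : (ε:ℂ) ≠ 0 := by exact_mod_cast hε.ne'
      push_cast
      field_simp
      simp
    rw [this, Complex.I_mul_im, Complex.ofReal_re]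
    field_simp
  have h4 := h2.const_mul (1/(N:ℂ))
  rw [mul_one] at h4
  refine h4.congr' ?_
  filter_upwards [self_mem_nhdsWithin] with ε hε
  have hε : 0 < ε := hε
  have him : 0 < (Complex.I * ((N:ℝ)^2 * ε : ℝ)).im := by
    rw [Complex.I_mul_im, Complex.ofReal_re]; positivity
  have h5 := (theta_L1 ((r / N : ℝ):ℂ) _ him).tsum_eq
  have h6 : (-Complex.I * (Complex.I * ((N:ℝ)^2 * ε : ℝ)))^(1/2 : ℂ) = ((N * Real.sqrt ε : ℝ) : ℂ) := by
    have : -Complex.I * (Complex.I * ((N:ℝ)^2 * ε : ℝ)) = (((N:ℝ)^2 * ε : ℝ) : ℂ) := by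
      rw [← mul_assoc]; simp
    rw [this]
    have : (1/2:ℂ) = ((1/2:ℝ):ℂ) := by push_cast; rfl
    rw [this, ← Complex.ofReal_cpow (by positivity), ← Real.sqrt_eq_rpow]
    rw [Real.sqrt_mul (by positivity), Real.sqrt_sq hNr.le]
  rw [h6] at h5
  have h7 : (∑' m : ℤ, Complex.exp (-Real.pi * ε * ((N:ℂ) * m + r)^2)) =
      1 / ((N * Real.sqrt ε : ℝ) : ℂ) * jacobiTheta₂ ((r / N : ℝ):ℂ) (-1/(Complex.I * ((N:ℝ)^2 * ε : ℝ))) := by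
    rw [← h5]
    congr 1
    ext m
    congr 1
    push_cast
    field_simp
    rw [Complex.I_sq]
    ring
  rw [h7]
  have hs : (Real.sqrt ε : ℂ) ≠ 0 := by
    exact_mod_cast (Real.sqrt_pos.2 hε).ne'
  push_cast
  field_simp

lemma cpow_half_real_mul (r : ℝ) (hr : 0 < r) (z : ℂ) (hz : z ≠ 0) :
    ((r:ℂ) * z)^(1/2:ℂ) = (Real.sqrt r : ℂ) * z^(1/2:ℂ) := by
  have hr' : (r:ℂ) ≠ 0 := by exact_mod_cast hr.ne'
  rw [Complex.cpow_def_of_ne_zero (mul_ne_zero hr' hz), Complex.cpow_def_of_ne_zero hz,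
    Complex.log_ofReal_mul hr hz, add_mul, Complex.exp_add]
  congr 1
  rw [Real.sqrt_eq_rpow, Complex.ofReal_cpow hr.le, Complex.cpow_def_of_ne_zero hr', Complex.ofReal_log hr.le]
  push_cast; rfl

open Filter Topology in
lemma gauss_lim_B (a b : ℤ) (ha : 0 < a) (hab : (2:ℤ) ∣ b - a) :
    Tendsto (fun ε : ℝ => (Real.sqrt ε : ℂ) *
        ∑' n : ℤ, Complex.exp (Real.pi * Complex.I * ((n:ℂ) + (b / 2 : ℝ))^2 * (1 / a + Complex.I * ε)))
      (𝓝[>] 0) (𝓝 (1 / (-Complex.I * (1 / a))^(1/2 : ℂ) * (1 / (Real.sqrt a * ((a:ℂ)^(1/2:ℂ)))))) := by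
  have har : (0:ℝ) < a := by exact_mod_cast ha
  have hac : (a:ℂ) ≠ 0 := by exact_mod_cast ha.ne'
  have hcont : Tendsto (fun ε : ℝ => (1 / a + Complex.I * ε : ℂ)) (𝓝[>] 0) (𝓝 (1 / a)) := by
    have : Continuous (fun ε : ℝ => (1 / a + Complex.I * ε : ℂ)) := by fun_prop
    have := this.tendsto 0
    simp only [Complex.ofReal_zero, mul_zero, add_zero] at this
    exact this.mono_left nhdsWithin_le_nhds
  have t1 : Tendsto (fun ε : ℝ => 1 / (-Complex.I * (1 / a + Complex.I * ε : ℂ))^(1/2 : ℂ)) (𝓝[>] 0)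
      (𝓝 (1 / (-Complex.I * (1 / a))^(1/2 : ℂ))) := by
    refine Tendsto.div tendsto_const_nhds ?_ ?_
    · refine Tendsto.cpow (hcont.const_mul _) tendsto_const_nhds ?_
      right
      have : (-Complex.I * (1 / a) : ℂ) = ((-(1/a) : ℝ) : ℂ) * Complex.I := by push_cast; ring
      rw [this, Complex.im_ofReal_mul]; simp [ha.ne']
    · rw [Complex.cpow_def_of_ne_zero (by simp [hac])]
      exact Complex.exp_ne_zero _
  have t2 : Tendsto (fun ε : ℝ => 1 / (Real.sqrt a * ((1 / (1 / a + Complex.I * ε : ℂ))^(1/2:ℂ)))) (𝓝[>] 0)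
      (𝓝 (1 / (Real.sqrt a * ((a:ℂ)^(1/2:ℂ))))) := by
    refine Tendsto.div tendsto_const_nhds ?_ ?_
    · refine Tendsto.const_mul _ ?_
      refine Tendsto.cpow ?_ tendsto_const_nhds ?_
      · have := hcont.inv₀ (by simp [hac])
        simpa using this
      · left; simpa using ha
    · rw [Complex.cpow_def_of_ne_zero hac]
      refine mul_ne_zero ?_ (Complex.exp_ne_zero _)
      exact_mod_cast (Real.sqrt_pos.2 har).ne'
  have t3 : Tendsto (fun ε : ℝ => jacobiTheta₂ ((0:ℝ):ℂ) (((-(1/a) : ℝ) : ℂ) + ((1/(a^2*ε) : ℝ) : ℂ) * Complex.I))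
      (𝓝[>] 0) (𝓝 1) := by
    apply theta_L2
    have h3 : Tendsto (fun ε : ℝ => (1/(a:ℝ)^2) * ε⁻¹) (𝓝[>] 0) atTop :=
      tendsto_inv_nhdsGT_zero.const_mul_atTop (by positivity)
    refine h3.congr ?_
    intro ε
    rw [Complex.add_im, Complex.ofReal_im, Complex.im_ofReal_mul, Complex.I_im]
    field_simp
    simp
  have t4 := (t1.mul t2).mul t3
  rw [mul_one] at t4
  refine t4.congr' ?_
  filter_upwards [self_mem_nhdsWithin] with ε hε
  have hε : 0 < ε := hε
  have hεc : (ε:ℂ) ≠ 0 := by exact_mod_cast hε.ne'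
  set τ : ℂ := 1 / a + Complex.I * ε with hτ
  have hτim : 0 < τ.im := by
    have : τ = ((1/a : ℝ) : ℂ) + (ε:ℂ) * Complex.I := by rw [hτ]; push_cast; ring
    rw [this, Complex.add_im, Complex.ofReal_im, Complex.im_ofReal_mul, Complex.I_im]
    simpa using hε
  have hτ0 : τ ≠ 0 := by intro h; rw [h] at hτim; simp at hτim
  rw [(theta_L1 _ τ hτim).tsum_eq]
  have e1 : jacobiTheta₂ ((b/2 : ℝ):ℂ) (-1/τ) = jacobiTheta₂ 0 (a - 1/τ) := by
    unfold jacobiTheta₂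
    congr 1
    ext m
    unfold jacobiTheta₂_term
    rw [Complex.exp_eq_exp_iff_exists_int]
    obtain ⟨d, hd⟩ := hab
    have hm : (2:ℤ) ∣ m * (m - 1) := (Int.even_mul_pred_self m).two_dvd
    obtain ⟨s, hs⟩ := hm
    have hb : (b:ℂ) = a + 2 * d := by
      have : b = a + 2 * d := by linarith
      exact_mod_cast this
    have hs' : (m:ℂ)^2 = m + 2 * s := by
      have : m^2 = m + 2 * s := by linarith
      exact_mod_cast this
    refine ⟨m * d - s * a, ?_⟩
    push_cast
    rw [hb]
    linear_combination (-Real.pi * Complex.I * a : ℂ) * hs'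
  have hw : (a - 1/τ : ℂ) = Complex.I * (((a * ε : ℝ) : ℂ) * (1/τ)) := by
    push_cast
    have : (a:ℂ) * τ - 1 = a * ε * Complex.I := by rw [hτ]; field_simp; ring
    field_simp
    linear_combination this
  have e2 : -1 / (a - 1/τ : ℂ) = (((-(1/a) : ℝ) : ℂ) + ((1/(a^2*ε) : ℝ) : ℂ) * Complex.I) := by
    rw [hw, hτ]
    have hτ0' : (1 / a + Complex.I * ε : ℂ) ≠ 0 := hτ0
    push_cast
    field_simp
    linear_combination (-1 : ℂ) * Complex.I_sq
  have e3 : -Complex.I * (a - 1/τ : ℂ) = ((a * ε : ℝ) : ℂ) * (1/τ) := by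
    rw [hw, ← mul_assoc]; simp
  rw [e1, jacobiTheta₂_functional_equation 0 (a - 1/τ), e2, e3, cpow_half_real_mul _ (by positivity) _ (by simp [hτ0]),
    Real.sqrt_mul har.le]
  have hs : (Real.sqrt ε : ℂ) ≠ 0 := by
    exact_mod_cast (Real.sqrt_pos.2 hε).ne'
  simp only [Complex.ofReal_zero, zero_div, ne_eq, OfNat.ofNat_ne_zero, not_false_eq_true, zero_pow, mul_zero, Complex.exp_zero, Complex.ofReal_mul, mul_one]
  generalize (1 / τ)^(1/2:ℂ) = X
  generalize (-Complex.I * τ)^(1/2:ℂ) = Y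
  simp only [one_div, mul_inv]
  rw [show (Real.sqrt ε : ℂ) * (Y⁻¹ * ((Real.sqrt (a:ℝ) : ℂ)⁻¹ * (Real.sqrt ε : ℂ)⁻¹ * X⁻¹ * jacobiTheta₂ 0 (((-(a:ℝ)⁻¹ : ℝ) : ℂ) + (((((a:ℝ) ^ 2)⁻¹ * ε⁻¹ : ℝ)) : ℂ) * Complex.I))) = ((Real.sqrt ε : ℂ) * (Real.sqrt ε : ℂ)⁻¹) * (Y⁻¹ * ((Real.sqrt (a:ℝ) : ℂ)⁻¹ * X⁻¹ * jacobiTheta₂ 0 (((-(a:ℝ)⁻¹ : ℝ) : ℂ) + (((((a:ℝ) ^ 2)⁻¹ * ε⁻¹ : ℝ)) : ℂ) * Complex.I))) by ring, mul_inv_cancel₀ hs]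
  ring

open Filter Topology in
lemma gauss_lim_A (N : ℕ) [NeZero N] (a b w : ℤ) (ha : 0 < a) (hN : (N:ℤ) = w * a) (hab : (2:ℤ) ∣ b - a) :
    Tendsto (fun ε : ℝ => (Real.sqrt ε : ℂ) *
        ∑' n : ℤ, Complex.exp (Real.pi * Complex.I * ((n:ℂ) + (b / 2 : ℝ))^2 * (1 / a + Complex.I * ε)))
      (𝓝[>] 0) (𝓝 (∑ t : Fin N, Complex.exp (Real.pi * Complex.I * ((t:ℕ) + b / 2)^2 * (1/a)) * (1 / N))) := by
  have har : (0:ℝ) < a := by exact_mod_cast ha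
  have hac : (a:ℂ) ≠ 0 := by exact_mod_cast ha.ne'
  have h1 : Tendsto (fun ε : ℝ => ∑ t : Fin N, Complex.exp (Real.pi * Complex.I * ((t:ℕ) + b / 2)^2 * (1/a)) *
      ((Real.sqrt ε : ℂ) * ∑' m : ℤ, Complex.exp (-Real.pi * ε * ((N:ℂ) * m + (((t:ℕ) + b/2 : ℝ) : ℂ))^2)))
      (𝓝[>] 0) (𝓝 (∑ t : Fin N, Complex.exp (Real.pi * Complex.I * ((t:ℕ) + b / 2)^2 * (1/a)) * (1 / N))) :=
    tendsto_finsetSum _ fun t _ => (theta_L3 N (NeZero.pos N) _).const_mul _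
  refine h1.congr' ?_
  filter_upwards [self_mem_nhdsWithin] with ε hε
  have hε : 0 < ε := hε
  have hτim : 0 < (1 / a + Complex.I * ε : ℂ).im := by
    have : (1 / a + Complex.I * ε : ℂ) = ((1/a : ℝ) : ℂ) + (ε:ℂ) * Complex.I := by push_cast; ring
    rw [this, Complex.add_im, Complex.ofReal_im, Complex.im_ofReal_mul, Complex.I_im]
    simpa using hε
  have hsum := (theta_L1 ((b/2 : ℝ):ℂ) _ hτim).summable
  have hsum' := (Int.divModEquiv N).symm.summable_iff.2 hsum
  rw [← (Int.divModEquiv N).symm.tsum_eq]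
  have hsum2 := (Equiv.prodComm (Fin N) ℤ).summable_iff.2 hsum'
  have hsum3 := hsum2.tsum_prod
  simp only [Function.comp_apply] at hsum3
  rw [← (Equiv.prodComm (Fin N) ℤ).tsum_eq, hsum3, tsum_fintype, Finset.mul_sum]
  refine Finset.sum_congr rfl fun t _ => ?_
  rw [mul_left_comm]
  congr 1
  rw [← tsum_mul_left]
  congr 1
  ext m
  rw [← Complex.exp_add, Complex.exp_eq_exp_iff_exists_int]
  obtain ⟨d, hd⟩ := hab
  have hb : (b:ℂ) = a + 2 * d := by
    have : b = a + 2 * d := by linarith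
    exact_mod_cast this
  have hN' : (N:ℂ) = w * a := by exact_mod_cast hN
  have hm : (2:ℤ) ∣ (w * m) * (w * m + 1) := (Int.even_mul_succ_self _).two_dvd
  obtain ⟨s, hs⟩ := hm
  have hs' : (w * m : ℂ) * (w * m + 1) = 2 * s := by exact_mod_cast hs
  refine ⟨-(w * m * t + w * m * d + a * s), ?_⟩
  simp only [Equiv.prodComm_apply, Prod.swap_prod_mk, Int.divModEquiv_symm_apply]
  push_cast
  rw [hN', hb]
  field_simp
  linear_combination (-4 * a^2 * Complex.I : ℂ) * hs' - (4 * a * ε * (w * a * m + (t:ℕ) + a / 2 + d)^2 : ℂ) * Complex.I_sq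

lemma gauss1 (N : ℕ) [NeZero N] (a b w : ℤ) (ha : 0 < a) (hN : (N:ℤ) = w * a) (hab : (2:ℤ) ∣ b - a) :
    ∃ p : ℝ, 0 < p ∧ ∑ t : Fin N, Complex.exp (Real.pi * Complex.I * ((t:ℕ) + b / 2)^2 * (1/a)) =
      p * Complex.exp (Real.pi * Complex.I / 4) := by
  have h := tendsto_nhds_unique (gauss_lim_A N a b w ha hN hab) (gauss_lim_B a b ha hab)
  have har : (0:ℝ) < a := by exact_mod_cast ha
  have hNr : (0:ℝ) < N := by exact_mod_cast NeZero.pos N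
  have hNc : (N:ℂ) ≠ 0 := by exact_mod_cast hNr.ne'
  have hac : (a:ℂ) ≠ 0 := by exact_mod_cast ha.ne'
  refine ⟨N * (1 / Real.sqrt (1/a) * (1 / (Real.sqrt a * Real.sqrt a))), by positivity, ?_⟩
  rw [← Finset.sum_mul] at h
  have e1 : (-Complex.I * (1 / a))^(1/2 : ℂ) = (Real.sqrt (1/a) : ℂ) * Complex.exp (-(Real.pi * Complex.I / 4)) := by
    have : (-Complex.I * (1 / a) : ℂ) = ((1/a : ℝ) : ℂ) * (-Complex.I) := by push_cast; ring
    rw [this, cpow_half_real_mul _ (by positivity) _ (by simp), Complex.cpow_def_of_ne_zero (by simp), Complex.log_neg_I]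
    congr 2
    ring
  have e2 : (a:ℂ)^(1/2:ℂ) = (Real.sqrt a : ℂ) := by
    have := cpow_half_real_mul a har 1 one_ne_zero
    simpa using this
  rw [e1, e2, Complex.exp_neg] at h
  have h' := congrArg (fun z => z * (N:ℂ)) h
  rw [mul_assoc, one_div_mul_cancel hNc, mul_one] at h'
  rw [h']
  push_cast
  simp only [one_div, mul_inv, inv_inv]
  ring

lemma diag_exists {n : ℕ} (P : Matrix (Fin n) (Fin n) ℤ) (hsymm : P.IsSymm)
    (hpos : ∀ x : Fin n → ℤ, x ≠ 0 → 0 < x ⬝ᵥ P *ᵥ x) :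
    ∃ (E : Matrix (Fin n) (Fin n) ℤ) (a : Fin n → ℤ), (∀ i, 0 < a i) ∧ Eᵀ * P * E = diagonal a := by
  classical
  set PQ : Matrix (Fin n) (Fin n) ℚ := P.map (Int.cast : ℤ → ℚ) with hPQ
  let B := Matrix.toBilin' PQ
  have hB : LinearMap.IsSymm B := by
    refine ⟨fun x y => ?_⟩
    simp only [B, RingHom.id_apply, Matrix.toBilin'_apply']
    have hs : PQᵀ = PQ := by
      rw [hPQ, ← Matrix.transpose_map, hsymm.eq]
    rw [Matrix.dotProduct_mulVec, ← Matrix.mulVec_transpose, hs, dotProduct_comm]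
  haveI : Invertible (2:ℚ) := invertibleOfNonzero (by norm_num)
  obtain ⟨u, hu⟩ := LinearMap.BilinForm.exists_orthogonal_basis hB
  have hfr : Module.finrank ℚ (Fin n → ℚ) = n := by simp
  let u' := u.reindex (finCongr hfr)
  have hu' : ∀ i j, i ≠ j → B (u' i) (u' j) = 0 := by
    intro i j hij
    simp only [u', Module.Basis.reindex_apply]
    exact hu (by simpa using hij)
  obtain ⟨d, hd⟩ := IsLocalization.exist_integer_multiples_of_finite (nonZeroDivisors ℤ)
    (fun p : Fin n × Fin n => u' p.1 p.2)
  choose z hz using hd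
  have hd0 : ((d:ℤ):ℚ) ≠ 0 := by
    have := nonZeroDivisors.ne_zero d.2
    exact_mod_cast this
  let e : Fin n → Fin n → ℤ := fun i j => z (i, j)
  have he : ∀ i, (fun j => (e i j : ℚ)) = (d:ℤ) • u' i := by
    intro i; ext j
    have := hz (i, j)
    simpa [e] using this
  have hcast : ∀ x y : Fin n → ℤ, ((x ⬝ᵥ P *ᵥ y : ℤ) : ℚ) = B (fun j => (x j : ℚ)) (fun j => (y j : ℚ)) := by
    intro x y
    simp only [B, Matrix.toBilin'_apply', dotProduct, Matrix.mulVec, hPQ, Matrix.map_apply]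
    push_cast
    rfl
  have hoff : ∀ i j, i ≠ j → e i ⬝ᵥ P *ᵥ e j = 0 := by
    intro i j hij
    have := hcast (e i) (e j)
    rw [he, he] at this
    rw [map_zsmul, map_zsmul, LinearMap.smul_apply, hu' i j hij, smul_zero, smul_zero] at this
    exact_mod_cast this
  have hne : ∀ i, e i ≠ 0 := by
    intro i h
    have h1 := he i
    have : u' i ≠ 0 := u'.ne_zero i
    apply this
    have h2 : ((d:ℤ):ℚ) • u' i = 0 := by
      rw [Int.cast_smul_eq_zsmul, ← h1, h]; ext; simp
    exact (smul_eq_zero.1 h2).resolve_left hd0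
  refine ⟨Matrix.of fun j i => e i j, fun i => e i ⬝ᵥ P *ᵥ e i, fun i => hpos _ (hne i), ?_⟩
  ext i j
  have : ((Matrix.of fun j i => e i j)ᵀ * P * (Matrix.of fun j i => e i j)) i j = e i ⬝ᵥ P *ᵥ e j := by
    rw [Matrix.mul_assoc, Matrix.mul_apply]
    simp [dotProduct, Matrix.mulVec, Matrix.mul_apply]
  rw [this, Matrix.diagonal_apply]
  split_ifs with h
  · rw [h]
  · exact hoff i j h

lemma sum_zmod_fin (N : ℕ) [NeZero N] (f : ℕ → ℂ) : ∑ t : ZMod N, f t.val = ∑ t : Fin N, f t := by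
  cases N with
  | zero => exact absurd rfl (NeZero.ne 0)
  | succ m => rfl

lemma blij {n : ℕ} (P : Matrix (Fin n) (Fin n) ℤ) (hsymm : P.IsSymm)
    (hpos : ∀ x : Fin n → ℤ, x ≠ 0 → 0 < x ⬝ᵥ P *ᵥ x) (hdet : P.det = 1) (v : Fin n → ℤ)
    (hv : ∀ x : Fin n → ℤ, 2 ∣ (x ⬝ᵥ P *ᵥ v - x ⬝ᵥ P *ᵥ x)) :
    (8:ℤ) ∣ n - v ⬝ᵥ P *ᵥ v := by
  classical
  obtain ⟨E, a, ha, hE⟩ := diag_exists P hsymm hpos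
  obtain ⟨N, hN⟩ : ∃ N : ℕ, (N:ℤ) = ∏ i, a i :=
    ⟨(∏ i, a i).toNat, Int.toNat_of_nonneg (Finset.prod_nonneg fun i _ => (ha i).le)⟩
  have hNpos : 0 < N := by
    have : (0:ℤ) < N := by rw [hN]; exact Finset.prod_pos fun i _ => ha i
    exact_mod_cast this
  haveI : NeZero N := ⟨hNpos.ne'⟩
  have hNc : (N:ℂ) ≠ 0 := by exact_mod_cast hNpos.ne'
  have hNz : (N:ℤ) ≠ 0 := by exact_mod_cast hNpos.ne'
  have hw : ∀ i, ∃ w : ℤ, (N:ℤ) = w * a i := by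
    intro i
    obtain ⟨w, hw⟩ := Finset.dvd_prod_of_mem a (Finset.mem_univ i)
    exact ⟨w, by rw [hN, hw, mul_comm]⟩
  choose w hw using hw
  set A := Eᵀ * P with hA
  set B := diagonal w * A with hBdef
  have hBE : B * E = (N:ℤ) • (1 : Matrix (Fin n) (Fin n) ℤ) := by
    rw [hBdef, Matrix.mul_assoc, hE, Matrix.diagonal_mul_diagonal, ← Matrix.diagonal_one]
    ext i j
    simp only [Matrix.diagonal_apply, Matrix.smul_apply]
    split_ifs
    · simp [hw i]
    · simp
  have hEB : E * B = (N:ℤ) • (1 : Matrix (Fin n) (Fin n) ℤ) := by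
    have hdE : E.det ≠ 0 := by
      intro h
      have := congrArg Matrix.det hBE
      rw [Matrix.det_mul, h, mul_zero, Matrix.det_smul, Matrix.det_one, mul_one] at this
      exact pow_ne_zero _ hNz this.symm
    have h1 : (E * B - (N:ℤ) • (1 : Matrix (Fin n) (Fin n) ℤ)) * E = 0 := by
      rw [Matrix.sub_mul, Matrix.mul_assoc, hBE, Matrix.mul_smul, Matrix.smul_mul, Matrix.mul_one, Matrix.one_mul, sub_self]
    have h2 := congrArg (fun M => M * E.adjugate) h1
    simp only [Matrix.mul_assoc, Matrix.mul_adjugate, Matrix.zero_mul, Matrix.mul_smul, Matrix.mul_one] at h2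
    exact sub_eq_zero.1 ((smul_eq_zero.1 h2).resolve_left hdE)
  have hAEw : A * (E * diagonal w) = (N:ℤ) • (1 : Matrix (Fin n) (Fin n) ℤ) := by
    rw [← Matrix.mul_assoc, hE, Matrix.diagonal_mul_diagonal, ← Matrix.diagonal_one]
    ext i j
    simp only [Matrix.diagonal_apply, Matrix.smul_apply]
    split_ifs
    · simp [hw i, mul_comm]
    · simp
  have hAt : Aᵀ * B = (N:ℤ) • P := by
    rw [hA, Matrix.transpose_mul, Matrix.transpose_transpose, hsymm.eq, Matrix.mul_assoc, hEB, Matrix.mul_smul, Matrix.mul_one]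
  set b := A *ᵥ v with hb
  have hab : ∀ i, (2:ℤ) ∣ b i - a i := by
    intro i
    have h1 := hv (fun j => E j i)
    have e1 : (fun j => E j i) ⬝ᵥ P *ᵥ v = b i := by
      rw [hb, hA, ← Matrix.mulVec_mulVec]; rfl
    have e2 : (fun j => E j i) ⬝ᵥ P *ᵥ (fun j => E j i) = a i := by
      have := congrFun (congrFun hE i) i
      rw [Matrix.diagonal_apply_eq, hA, Matrix.mul_assoc] at this
      rw [← this]; rfl
    rwa [e1, e2] at h1
  let q : (Fin n → ℤ) → ℤ := fun k => k ⬝ᵥ (diagonal w) *ᵥ (k + b)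
  have hdw : ∀ x y : Fin n → ℤ, x ⬝ᵥ (diagonal w) *ᵥ y = y ⬝ᵥ (diagonal w) *ᵥ x := by
    intro x y
    simp only [dotProduct, Matrix.mulVec_diagonal]
    exact Finset.sum_congr rfl fun i _ => by ring
  have hAB : ∀ x y : Fin n → ℤ, (A *ᵥ x) ⬝ᵥ (diagonal w) *ᵥ (A *ᵥ y) = N * (x ⬝ᵥ P *ᵥ y) := by
    intro x y
    rw [Matrix.mulVec_mulVec, ← hBdef, dotProduct_comm, Matrix.dotProduct_mulVec, ← Matrix.mulVec_transpose,
      Matrix.mulVec_mulVec, hAt, Matrix.smul_mulVec, smul_dotProduct, dotProduct_comm]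
    simp
  have hq : ∀ k x, q (k + A *ᵥ x) = q k + 2 * (k ⬝ᵥ B *ᵥ x) + N * (x ⬝ᵥ P *ᵥ x + x ⬝ᵥ P *ᵥ v) := by
    intro k x
    have h1 := hAB x x
    have h2 := hAB x v
    rw [← hb] at h2
    have h3 := hdw (A *ᵥ x) k
    have h4 : k ⬝ᵥ (diagonal w) *ᵥ (A *ᵥ x) = k ⬝ᵥ B *ᵥ x := by rw [Matrix.mulVec_mulVec]
    simp only [q, Matrix.mulVec_add, add_dotProduct, dotProduct_add]
    rw [h1, h2, h3, h4]
    ring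
  let φ : (Fin n → ℤ) → ℂ := fun k => Complex.exp (Real.pi * Complex.I * (q k) / N)
  have hφ : ∀ k x, φ (k + A *ᵥ x) = φ k * Complex.exp (2 * Real.pi * Complex.I * ((k ⬝ᵥ B *ᵥ x : ℤ) : ℂ) / N) := by
    intro k x
    simp only [φ]
    rw [← Complex.exp_add, Complex.exp_eq_exp_iff_exists_int, hq]
    obtain ⟨c, hc⟩ := hv x
    refine ⟨c + x ⬝ᵥ P *ᵥ x, ?_⟩
    have hc' : x ⬝ᵥ P *ᵥ v = x ⬝ᵥ P *ᵥ x + 2 * c := by linarith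
    rw [hc']
    push_cast
    field_simp
    ring
  have hφ0 : φ 0 = 1 := by simp [φ, q]
  have hper : ∀ k y, φ (k + (N:ℤ) • y) = φ k := by
    intro k y
    have e1 : (N:ℤ) • y = A *ᵥ ((E * diagonal w) *ᵥ y) := by
      rw [Matrix.mulVec_mulVec, hAEw, Matrix.smul_mulVec, Matrix.one_mulVec]
    have e2 : B *ᵥ ((E * diagonal w) *ᵥ y) = (N:ℤ) • (diagonal w *ᵥ y) := by
      rw [Matrix.mulVec_mulVec, ← Matrix.mul_assoc, hBE, ← Matrix.smul_mulVec]; simp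
    rw [e1, hφ, e2, dotProduct_smul]
    have : Complex.exp (2 * Real.pi * Complex.I * (((N:ℤ) • (k ⬝ᵥ diagonal w *ᵥ y) : ℤ) : ℂ) / N) = 1 := by
      rw [Complex.exp_eq_one_iff]
      refine ⟨k ⬝ᵥ diagonal w *ᵥ y, ?_⟩
      rw [smul_eq_mul]
      push_cast
      field_simp
    rw [this, mul_one]
  let l : (Fin n → ZMod N) → (Fin n → ℤ) := fun κ i => ((κ i).val : ℤ)
  let c : (Fin n → ℤ) → (Fin n → ZMod N) := fun k i => (k i : ZMod N)
  have hcl : ∀ κ, c (l κ) = κ := by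
    intro κ; ext i; simp [c, l]
  have hlc : ∀ k, φ (l (c k)) = φ k := by
    intro k
    have : l (c k) = k + (N:ℤ) • (fun i => -(k i / N)) := by
      ext i
      simp only [l, c, ZMod.val_intCast, Pi.add_apply, Pi.smul_apply, smul_eq_mul]
      have := Int.mul_ediv_add_emod (k i) N
      linarith
    rw [this, hper]
  let ψ : (Fin n → ℤ) → AddChar (Fin n → ZMod N) ℂ := fun k =>
    (ZMod.stdAddChar (N := N)).compAddMonoidHom
      { toFun := fun x => (c (Bᵀ *ᵥ k)) ⬝ᵥ x
        map_zero' := by simp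
        map_add' := by intro x y; simp [dotProduct_add] }
  have hψ : ∀ k x, ψ k (c x) = Complex.exp (2 * Real.pi * Complex.I * ((k ⬝ᵥ B *ᵥ x : ℤ) : ℂ) / N) := by
    intro k x
    have : (c (Bᵀ *ᵥ k)) ⬝ᵥ (c x) = ((k ⬝ᵥ B *ᵥ x : ℤ) : ZMod N) := by
      rw [Matrix.dotProduct_mulVec, ← Matrix.mulVec_transpose]
      simp [c, dotProduct]
    rw [← ZMod.stdAddChar_coe, ← this]
    rfl
  have hψ0 : ∀ k, ψ k = 0 → φ k = 1 := by
    intro k hk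
    have h1 : ∀ j, ∃ y : ℤ, (Bᵀ *ᵥ k) j = N * y := by
      intro j
      have h2 := hψ k (Pi.single j 1)
      rw [hk, AddChar.zero_apply] at h2
      obtain ⟨m, hm⟩ := Complex.exp_eq_one_iff.1 h2.symm
      refine ⟨m, ?_⟩
      rw [Matrix.dotProduct_mulVec, ← Matrix.mulVec_transpose, dotProduct_single_one] at hm
      have hpi : (Real.pi : ℂ) ≠ 0 := by exact_mod_cast Real.pi_ne_zero
      have hI := Complex.I_ne_zero
      field_simp at hm
      exact_mod_cast hm
    choose y hy using h1
    have hy' : Bᵀ *ᵥ k = (N:ℤ) • y := by ext j; simp [hy j]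
    have h3 : Eᵀ *ᵥ (Bᵀ *ᵥ k) = (N:ℤ) • k := by
      rw [Matrix.mulVec_mulVec, ← Matrix.transpose_mul, hBE]
      simp [Matrix.smul_mulVec]
    rw [hy', Matrix.mulVec_smul] at h3
    have h4 : Eᵀ *ᵥ y = k := smul_right_injective _ hNz h3
    have h5 : k = 0 + A *ᵥ (P⁻¹ *ᵥ y) := by
      rw [zero_add, hA, Matrix.mulVec_mulVec, Matrix.mul_assoc, Matrix.mul_nonsing_inv _ (by simp [hdet]), Matrix.mul_one, h4]
    rw [h5, hφ, hφ0]; simp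
  -- the sum
  let S : ℂ := ∑ κ, φ (l κ)
  have hSx : ∀ x, S = ∑ κ, φ (l κ) * ψ (l κ) x := by
    intro x
    simp only [S]
    rw [← Equiv.sum_comp (Equiv.addRight (c (A *ᵥ l x)))]
    refine Finset.sum_congr rfl fun κ _ => ?_
    have h1 : (Equiv.addRight (c (A *ᵥ l x))) κ = c (l κ + A *ᵥ l x) := by
      have : c (l κ + A *ᵥ l x) = c (l κ) + c (A *ᵥ l x) := by ext i; simp [c]
      rw [this, hcl]; rfl
    rw [h1, hlc, hφ, ← hψ, hcl]
  have hSN : (Fintype.card (Fin n → ZMod N) : ℂ) * S =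
      ((∑ κ, if ψ (l κ) = 0 then (Fintype.card (Fin n → ZMod N) : ℝ) else 0 : ℝ) : ℂ) := by
    have h1 : (Fintype.card (Fin n → ZMod N) : ℂ) * S = ∑ x : Fin n → ZMod N, S := by
      rw [Finset.sum_const, nsmul_eq_mul]; rfl
    rw [h1, Finset.sum_congr rfl fun x _ => hSx x, Finset.sum_comm]
    push_cast
    refine Finset.sum_congr rfl fun κ _ => ?_
    rw [← Finset.mul_sum, AddChar.sum_eq_ite]
    split_ifs with h
    · rw [hψ0 _ h, one_mul]; simp
    · simp
  have hcard : (0:ℝ) < Fintype.card (Fin n → ZMod N) := by exact_mod_cast Fintype.card_pos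
  have hpos' : 0 < ∑ κ : Fin n → ZMod N, if ψ (l κ) = 0 then (Fintype.card (Fin n → ZMod N) : ℝ) else 0 := by
    refine Finset.sum_pos' (fun κ _ => by split_ifs <;> positivity) ⟨0, Finset.mem_univ _, ?_⟩
    have hl0 : l 0 = 0 := by ext i; simp [l]
    have : ψ (l 0) = 0 := by
      rw [hl0]; ext x
      rw [← hcl x, hψ]; simp
    rw [if_pos this]; exact hcard
  choose p hp hp2 using fun i => gauss1 N (a i) (b i) (w i) (ha i) (hw i) (hab i)
  have hSprod : S = ∏ i, ((p i : ℂ) * Complex.exp (Real.pi * Complex.I / 4 - Real.pi * Complex.I * (w i * (b i)^2) / (4 * N))) := by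
    have h1 : ∀ i, ((p i : ℂ) * Complex.exp (Real.pi * Complex.I / 4 - Real.pi * Complex.I * (w i * (b i)^2) / (4 * N))) =
        ∑ t : ZMod N, Complex.exp (Real.pi * Complex.I * (w i * ((t.val:ℂ) * (t.val + b i))) / N) := by
      intro i
      rw [sum_zmod_fin N (fun t => Complex.exp (Real.pi * Complex.I * (w i * ((t:ℂ) * (t + b i))) / N)),
        sub_eq_add_neg, Complex.exp_add, ← mul_assoc, ← hp2 i, Finset.sum_mul]
      refine Finset.sum_congr rfl fun t _ => ?_
      rw [← Complex.exp_add]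
      congr 1
      have hNa : (N:ℂ) = w i * a i := by exact_mod_cast hw i
      have hai : (a i : ℂ) ≠ 0 := by exact_mod_cast (ha i).ne'
      have hwi : (w i : ℂ) ≠ 0 := by
        intro h; rw [h, zero_mul] at hNa; exact hNc hNa
      rw [hNa]
      field_simp
      ring
    rw [Finset.prod_congr rfl fun i _ => h1 i, Finset.prod_univ_sum, Fintype.piFinset_univ]
    refine Finset.sum_congr rfl fun κ _ => ?_
    rw [← Complex.exp_sum]
    simp only [φ]
    congr 1
    rw [← Finset.sum_div, ← Finset.mul_sum]
    congr 2
    simp only [q, dotProduct, Matrix.mulVec_diagonal, l, Pi.add_apply]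
    push_cast
    refine Finset.sum_congr rfl fun i _ => by ring
  have hbb : ∑ i, (w i : ℂ) * (b i)^2 = N * ((v ⬝ᵥ P *ᵥ v : ℤ) : ℂ) := by
    have h1 := hAB v v
    rw [← hb] at h1
    have h2 : ∑ i, w i * (b i)^2 = N * (v ⬝ᵥ P *ᵥ v) := by
      rw [← h1]
      simp only [dotProduct, Matrix.mulVec_diagonal]
      exact Finset.sum_congr rfl fun i _ => by ring
    exact_mod_cast h2
  have hSe : S = ((∏ i, p i : ℝ) : ℂ) * Complex.exp (((Real.pi * ((n:ℝ) - ((v ⬝ᵥ P *ᵥ v : ℤ) : ℝ)) / 4 : ℝ) : ℂ) * Complex.I) := by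
    rw [hSprod, Finset.prod_mul_distrib, ← Complex.exp_sum, Finset.sum_sub_distrib,
      ← Finset.sum_div Finset.univ (fun i => (Real.pi * Complex.I * (w i * (b i)^2) : ℂ)) (4 * N : ℂ),
      ← Finset.mul_sum Finset.univ (fun i => (w i * (b i)^2 : ℂ)), hbb]
    push_cast
    congr 2
    rw [Finset.sum_const, Finset.card_univ, Fintype.card_fin, nsmul_eq_mul]
    field_simp
  have hpp : 0 < ∏ i, p i := Finset.prod_pos fun i _ => hp i
  set C : ℝ := (Fintype.card (Fin n → ZMod N) : ℝ)
  set T : ℝ := ∑ κ : Fin n → ZMod N, if ψ (l κ) = 0 then C else 0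
  set θ : ℝ := Real.pi * ((n:ℝ) - ((v ⬝ᵥ P *ᵥ v : ℤ) : ℝ)) / 4 with hθ
  have hfin : ((C * ∏ i, p i : ℝ) : ℂ) * Complex.exp (θ * Complex.I) = (T : ℂ) := by
    rw [← hSN, hSe]; simp only [C]; push_cast; ring
  have hnorm := congrArg norm hfin
  rw [norm_mul, Complex.norm_exp_ofReal_mul_I, mul_one, Complex.norm_real, Complex.norm_real,
    Real.norm_of_nonneg (by positivity), Real.norm_of_nonneg hpos'.le] at hnorm
  rw [← hnorm] at hfin
  have hne : ((C * ∏ i, p i : ℝ) : ℂ) ≠ 0 := by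
    have : C * ∏ i, p i ≠ 0 := by positivity
    exact_mod_cast this
  have hone : Complex.exp (θ * Complex.I) = 1 := mul_left_cancel₀ hne (by rw [hfin, mul_one])
  obtain ⟨m, hm⟩ := Complex.exp_eq_one_iff.1 hone
  refine ⟨m, ?_⟩
  have hpi : (Real.pi : ℂ) ≠ 0 := by exact_mod_cast Real.pi_ne_zero
  have hI := Complex.I_ne_zero
  rw [hθ] at hm
  push_cast at hm
  have hm2 : ((n:ℂ) - ((v ⬝ᵥ P *ᵥ v : ℤ) : ℂ)) = 8 * m := by
    have : (Real.pi * Complex.I : ℂ) * ((n:ℂ) - ((v ⬝ᵥ P *ᵥ v : ℤ) : ℂ)) = (Real.pi * Complex.I) * (8 * m) := by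
      linear_combination 4 * hm
    exact mul_left_cancel₀ (mul_ne_zero hpi hI) this
  exact_mod_cast hm2

/-- An integral reflection in a vector of norm 1 or 2. -/
lemma refl_exists {n : ℕ} (P : Matrix (Fin n) (Fin n) ℤ) (hsymm : P.IsSymm) (u : Fin n → ℤ) (s : ℤ)
    (hs : s * (u ⬝ᵥ P *ᵥ u) = 2) :
    ∃ σ : (Fin n → ℤ) ≃ₗ[ℤ] (Fin n → ℤ),
      (∀ x y : Fin n → ℤ, σ x ⬝ᵥ P *ᵥ σ y = x ⬝ᵥ P *ᵥ y) ∧ ∀ x, σ x = x - (s * (u ⬝ᵥ P *ᵥ x)) • u := by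
  have hcomm : ∀ x y : Fin n → ℤ, x ⬝ᵥ P *ᵥ y = y ⬝ᵥ P *ᵥ x := by
    intro x y
    rw [Matrix.dotProduct_mulVec, ← Matrix.mulVec_transpose, hsymm.eq, dotProduct_comm]
  let f : (Fin n → ℤ) →ₗ[ℤ] (Fin n → ℤ) :=
    { toFun := fun x => x - (s * (u ⬝ᵥ P *ᵥ x)) • u
      map_add' := by
        intro x y; simp only [Matrix.mulVec_add, dotProduct_add, mul_add, add_smul]; abel
      map_smul' := by
        intro c x
        simp only [Matrix.mulVec_smul, dotProduct_smul, RingHom.id_apply, smul_sub, smul_smul, smul_eq_mul]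
        congr 2; ring }
  have hf : ∀ x, f x = x - (s * (u ⬝ᵥ P *ᵥ x)) • u := fun x => rfl
  have hinv : Function.Involutive f := by
    intro x
    rw [hf, hf, Matrix.mulVec_sub, dotProduct_sub, Matrix.mulVec_smul, dotProduct_smul, smul_eq_mul, sub_sub, ← add_smul]
    have : s * (u ⬝ᵥ P *ᵥ x) + s * (u ⬝ᵥ P *ᵥ x - s * (u ⬝ᵥ P *ᵥ x) * (u ⬝ᵥ P *ᵥ u)) = 0 := by
      linear_combination (-s * (u ⬝ᵥ P *ᵥ x)) * hs
    rw [this]; simp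
  refine ⟨LinearEquiv.ofInvolutive f hinv, ?_, fun x => rfl⟩
  intro x y
  change f x ⬝ᵥ P *ᵥ f y = _
  rw [hf, hf]
  simp only [Matrix.mulVec_sub, dotProduct_sub, Matrix.mulVec_smul, dotProduct_smul, smul_eq_mul, sub_dotProduct, smul_dotProduct]
  rw [hcomm x u]
  linear_combination (s * (u ⬝ᵥ P *ᵥ x) * (u ⬝ᵥ P *ᵥ y)) * hs

/-- Let `L = ℤⁿ` (Gram matrix `P`) be an exceptional unimodular lattice of rank `n` with
`n ≢ 6, 7 (mod 8)`. Then `O(L)` acts transitively on `Exc L`: for any two characteristic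
vectors `v, v'` of norm `< 8` there is an isometry `σ` of `L` with `σ v = v'`. -/
theorem isometry_group_transitive_on_exceptional_vectors
    {n : ℕ} (P : Matrix (Fin n) (Fin n) ℤ) (hsymm : P.IsSymm)
    (hpos : ∀ x : Fin n → ℤ, x ≠ 0 → 0 < x ⬝ᵥ P *ᵥ x) (hdet : P.det = 1)
    (h6 : n % 8 ≠ 6) (h7 : n % 8 ≠ 7)
    (hexc : ∃ ξ : Fin n → ℤ, (∀ x : Fin n → ℤ, 2 ∣ (x ⬝ᵥ P *ᵥ ξ - x ⬝ᵥ P *ᵥ x)) ∧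
      ξ ⬝ᵥ P *ᵥ ξ < 8) :
    ∀ v v' : Fin n → ℤ,
      (∀ x : Fin n → ℤ, 2 ∣ (x ⬝ᵥ P *ᵥ v - x ⬝ᵥ P *ᵥ x)) → v ⬝ᵥ P *ᵥ v < 8 →
      (∀ x : Fin n → ℤ, 2 ∣ (x ⬝ᵥ P *ᵥ v' - x ⬝ᵥ P *ᵥ x)) → v' ⬝ᵥ P *ᵥ v' < 8 →
      ∃ σ : (Fin n → ℤ) ≃ₗ[ℤ] (Fin n → ℤ),
        (∀ x y : Fin n → ℤ, σ x ⬝ᵥ P *ᵥ σ y = x ⬝ᵥ P *ᵥ y) ∧ σ v = v' := by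
  intro v v' hv hv8 hv' hv8'
  have hnn : ∀ x : Fin n → ℤ, 0 ≤ x ⬝ᵥ P *ᵥ x := by
    intro x
    by_cases h : x = 0
    · simp [h]
    · exact (hpos x h).le
  have hcomm : ∀ x y : Fin n → ℤ, x ⬝ᵥ P *ᵥ y = y ⬝ᵥ P *ᵥ x := by
    intro x y
    rw [Matrix.dotProduct_mulVec, ← Matrix.mulVec_transpose, hsymm.eq, dotProduct_comm]
  have b1 := blij P hsymm hpos hdet v hv
  have b2 := blij P hsymm hpos hdet v' hv'
  have n1 := hnn v
  have n2 := hnn v'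
  have heq : v ⬝ᵥ P *ᵥ v = v' ⬝ᵥ P *ᵥ v' := by omega
  have hle : v ⬝ᵥ P *ᵥ v ≤ 5 := by omega
  -- v - v' is divisible by 2
  have hdiv : ∀ i, ∃ c : ℤ, v i - v' i = 2 * c := by
    have h1 : ∀ x : Fin n → ℤ, (2:ℤ) ∣ x ⬝ᵥ P *ᵥ (v - v') := by
      intro x
      have := dvd_sub (hv x) (hv' x)
      rw [Matrix.mulVec_sub, dotProduct_sub]
      rwa [sub_sub_sub_cancel_right] at this
    intro i
    have h2 := h1 (P⁻¹ *ᵥ Pi.single i 1)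
    rw [hcomm, Matrix.mulVec_mulVec, Matrix.mul_nonsing_inv _ (by simp [hdet]), Matrix.one_mulVec, dotProduct_single_one] at h2
    exact h2
  choose u hu using hdiv
  have hvu : v = v' + (2:ℤ) • u := by ext i; simp; linarith [hu i]
  have hvv : v ⬝ᵥ P *ᵥ v = v' ⬝ᵥ P *ᵥ v' + 4 * (u ⬝ᵥ P *ᵥ v') + 4 * (u ⬝ᵥ P *ᵥ u) := by
    rw [hvu]
    simp only [Matrix.mulVec_add, dotProduct_add, Matrix.mulVec_smul, dotProduct_smul, smul_eq_mul, add_dotProduct, smul_dotProduct]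
    rw [hcomm v' u]; ring
  have huv' : u ⬝ᵥ P *ᵥ v' = - (u ⬝ᵥ P *ᵥ u) := by linarith
  have huv : u ⬝ᵥ P *ᵥ v = u ⬝ᵥ P *ᵥ u := by
    rw [hvu]
    simp only [Matrix.mulVec_add, dotProduct_add, Matrix.mulVec_smul, dotProduct_smul, smul_eq_mul]
    rw [huv']; ring
  set r := v' ⬝ᵥ P *ᵥ v'
  have ht : (v' + u) ⬝ᵥ P *ᵥ (v' + u) = r - u ⬝ᵥ P *ᵥ u := by
    simp only [Matrix.mulVec_add, dotProduct_add, add_dotProduct]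
    rw [hcomm v' u, huv']; ring
  have htv : (v' + u) ⬝ᵥ P *ᵥ v = r - u ⬝ᵥ P *ᵥ u := by
    rw [← ht, hvu]
    simp only [Matrix.mulVec_add, dotProduct_add, add_dotProduct, Matrix.mulVec_smul, dotProduct_smul, smul_eq_mul]
    rw [hcomm v' u, huv']; ring
  have hs : ∀ m : ℤ, m = 1 ∨ m = 2 → ∃ s : ℤ, s * m = 2 := by
    rintro m (rfl | rfl)
    · exact ⟨2, by norm_num⟩
    · exact ⟨1, by norm_num⟩
  have n3 := hnn u
  have n4 := hnn (v' + u)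
  rw [ht] at n4
  by_cases hsmall : u ⬝ᵥ P *ᵥ u ≤ 2
  · by_cases h0 : u = 0
    · refine ⟨LinearEquiv.refl ℤ _, fun x y => rfl, ?_⟩
      simp [hvu, h0]
    · have := hpos u h0
      obtain ⟨s, hs⟩ := hs (u ⬝ᵥ P *ᵥ u) (by omega)
      obtain ⟨σ, h1, h2⟩ := refl_exists P hsymm u s hs
      refine ⟨σ, h1, ?_⟩
      rw [h2, huv, hs, hvu]; simp
  · by_cases h0 : v' + u = 0
    · refine ⟨LinearEquiv.neg ℤ, fun x y => by simp [Matrix.mulVec_neg], ?_⟩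
      rw [LinearEquiv.neg_apply, hvu]
      have : u = -v' := by rw [eq_neg_iff_add_eq_zero, add_comm, h0]
      rw [this]; ext i; simp [two_mul]
    · have := hpos _ h0
      rw [ht] at this
      obtain ⟨s, hs⟩ := hs (r - u ⬝ᵥ P *ᵥ u) (by omega)
      obtain ⟨σ, h1, h2⟩ := refl_exists P hsymm (v' + u) s (by rw [ht, hs])
      refine ⟨σ.trans (LinearEquiv.neg ℤ), fun x y => by simp [Matrix.mulVec_neg, h1], ?_⟩
      rw [LinearEquiv.trans_apply, LinearEquiv.neg_apply, h2, htv, hs, hvu]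
      ext i; simp; ring
end

section
/- Let L be an exceptional unimodular integral lattice of rank n with n ≡ 5 (mod 8) and containing no vector of norm 1. Then the number of characteristic vectors of L of norm < 8 equals 2m for some integer m with 1 ≤ m ≤ n, and the subgroup W(L)^± of O(L) generated by −id and the reflections along roots of L acts transitively on Exc L. -/
open Matrix

/-- The group `W(L)^±` of the lattice `ℤⁿ` with Gram matrix `P`: the subgroup of linear
automorphisms generated by `−id` together with the reflections `sₐ(x) = x − (x·α)•α`
along the roots `α` (vectors of norm 2). -/
def weylPM {n : ℕ} (P : Matrix (Fin n) (Fin n) ℤ) :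
    Subgroup ((Fin n → ℤ) ≃ₗ[ℤ] (Fin n → ℤ)) :=
  Subgroup.closure
    ({σ | ∃ α : Fin n → ℤ, α ⬝ᵥ P *ᵥ α = 2 ∧ ∀ x, σ x = x - (x ⬝ᵥ P *ᵥ α) • α} ∪
      {σ | ∀ x, σ x = -x})

/-- The mod 4 form of van der Blij's congruence, as a property of a symmetric matrix. -/
def Good4 {ι : Type} [Fintype ι] [DecidableEq ι] (M : Matrix ι ι (ZMod 4)) : Prop :=
  ∀ ξ : ι → ZMod 4, (∀ x : ι → ZMod 4, 2 * (x ⬝ᵥ M *ᵥ ξ) = 2 * (x ⬝ᵥ M *ᵥ x)) →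
    ξ ⬝ᵥ M *ᵥ ξ = (Fintype.card ι : ZMod 4) + M.det - 1

lemma good4_congr {ι : Type} [Fintype ι] [DecidableEq ι] (N U V : Matrix ι ι (ZMod 4))
    (hUV : U * V = 1) (hdet : U.det = 1) (h : Good4 N) : Good4 (Uᵀ * N * U) := by
  have key : ∀ x y : ι → ZMod 4, x ⬝ᵥ (Uᵀ * N * U) *ᵥ y = (U *ᵥ x) ⬝ᵥ N *ᵥ (U *ᵥ y) := by
    intro x y
    rw [← Matrix.mulVec_mulVec, ← Matrix.mulVec_mulVec, Matrix.dotProduct_mulVec,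
      Matrix.vecMul_transpose]
  intro ξ hξ
  rw [key, h (U *ᵥ ξ), Matrix.det_mul, Matrix.det_mul, Matrix.det_transpose, hdet]
  · simp
  · intro x
    have := hξ (V *ᵥ x)
    rw [key, key, Matrix.mulVec_mulVec, hUV, Matrix.one_mulVec] at this
    exact this

lemma good4_reindex {ι κ : Type} [Fintype ι] [DecidableEq ι] [Fintype κ] [DecidableEq κ]
    (e : κ ≃ ι) (M : Matrix ι ι (ZMod 4)) (h : Good4 (M.submatrix e e)) : Good4 M := by
  have key : ∀ x y : ι → ZMod 4, (x ∘ e) ⬝ᵥ (M.submatrix e e) *ᵥ (y ∘ e) = x ⬝ᵥ M *ᵥ y := by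
    intro x y
    rw [Matrix.submatrix_mulVec_equiv]
    simp [Function.comp_assoc]
  intro ξ hξ
  have := h (ξ ∘ e) (by
    intro x
    have h2 := hξ (x ∘ e.symm)
    rw [← key, ← key] at h2
    simpa [Function.comp_assoc] using h2)
  rw [key, Matrix.det_submatrix_equiv_self, Fintype.card_congr e] at this
  exact this

lemma zmod4_aux : ∀ a b : ZMod 4, IsUnit (a * b) → (a - 1) * (b - 1) = 0 := by
  have : ∀ a b : ZMod 4, 2 * (a * b) = 2 → (a - 1) * (b - 1) = 0 := by decide
  have h2 : ∀ c d : ZMod 4, c * d = 1 → 2 * c = 2 := by decide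
  intro a b h
  obtain ⟨d, hd⟩ := h.exists_right_inv
  exact this a b (h2 _ d hd)

lemma good4_diag {ι κ : Type} [Fintype ι] [DecidableEq ι] [Fintype κ] [DecidableEq κ]
    (B : Matrix ι ι (ZMod 4)) (S : Matrix κ κ (ZMod 4)) (hu : IsUnit (B.det * S.det))
    (hB : Good4 B) (hS : Good4 S) : Good4 (fromBlocks B 0 0 S) := by
  have key : ∀ x y : ι ⊕ κ → ZMod 4, x ⬝ᵥ (fromBlocks B 0 0 S) *ᵥ y =
      (x ∘ Sum.inl) ⬝ᵥ B *ᵥ (y ∘ Sum.inl) + (x ∘ Sum.inr) ⬝ᵥ S *ᵥ (y ∘ Sum.inr) := by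
    intro x y
    rw [Matrix.fromBlocks_mulVec]
    simp [dotProduct, Fintype.sum_sum_type]
  intro ξ hξ
  have h1 := hB (ξ ∘ Sum.inl) (by
    intro x
    have := hξ (Sum.elim x 0)
    rw [key, key] at this
    simpa using this)
  have h2 := hS (ξ ∘ Sum.inr) (by
    intro x
    have := hξ (Sum.elim 0 x)
    rw [key, key] at this
    simpa using this)
  rw [key, h1, h2, Matrix.det_fromBlocks_zero₂₁, Fintype.card_sum]
  have := zmod4_aux _ _ hu
  push_cast
  linear_combination -this

lemma good4_block {ι κ : Type} [Fintype ι] [DecidableEq ι] [Fintype κ] [DecidableEq κ]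
    (M : Matrix (ι ⊕ κ) (ι ⊕ κ) (ZMod 4)) (hM : M.IsSymm) (hMu : IsUnit M.det)
    (hBu : IsUnit M.toBlocks₁₁.det) (hB : Good4 M.toBlocks₁₁)
    (IH : ∀ S : Matrix κ κ (ZMod 4), S.IsSymm → IsUnit S.det → Good4 S) : Good4 M := by
  obtain ⟨B, C, C', D, rfl⟩ : ∃ B C C' D, M = fromBlocks B C C' D :=
    ⟨_, _, _, _, (Matrix.fromBlocks_toBlocks M).symm⟩
  rw [Matrix.toBlocks_fromBlocks₁₁] at hBu hB
  rw [Matrix.isSymm_fromBlocks_iff] at hM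
  obtain ⟨hBs, hC, hC', hD⟩ := hM
  subst hC
  let _ := Matrix.invertibleOfIsUnitDet B hBu
  have hinvs : (⅟B)ᵀ = ⅟B := by
    rw [Matrix.invOf_eq_nonsing_inv, Matrix.transpose_nonsing_inv, hBs.eq]
  have hdet := Matrix.det_fromBlocks₁₁ B C Cᵀ D
  rw [hdet] at hMu
  have hS : Good4 (D - Cᵀ * ⅟B * C) := by
    apply IH
    · rw [Matrix.IsSymm, Matrix.transpose_sub, hD.eq]
      simp only [Matrix.transpose_mul, hinvs, Matrix.mul_assoc, Matrix.transpose_transpose]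
    · exact isUnit_of_mul_isUnit_right hMu
  have h := good4_congr (fromBlocks B 0 0 (D - Cᵀ * ⅟B * C)) (fromBlocks 1 (⅟B * C) 0 1)
    (fromBlocks 1 (-(⅟B * C)) 0 1) (by simp [Matrix.fromBlocks_multiply])
    (by simp) (good4_diag B _ hMu hB hS)
  have e := Matrix.fromBlocks_eq_of_invertible₁₁ B C Cᵀ D
  have e2 : (fromBlocks (1 : Matrix ι ι (ZMod 4)) (⅟B * C) 0 (1 : Matrix κ κ (ZMod 4)))ᵀ
      = fromBlocks 1 0 (Cᵀ * ⅟B) 1 := by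
    rw [Matrix.fromBlocks_transpose]
    simp only [Matrix.transpose_mul, hinvs, Matrix.transpose_one, Matrix.transpose_zero]
  rw [e2, ← e] at h
  exact h

lemma good4_one (M : Matrix Unit Unit (ZMod 4)) (hu : 2 * M () () = 2) : Good4 M := by
  intro ξ h
  have h1 := h 1
  simp [dotProduct, Matrix.mulVec] at h1 ⊢
  generalize M () () = a at *
  generalize ξ () = x at *
  revert a x
  decide

lemma good4_two (M : Matrix (Fin 2) (Fin 2) (ZMod 4)) (h0 : 2 * M 0 0 = 0) (h1 : 2 * M 1 1 = 0)
    (hs : M 1 0 = M 0 1) (hb : 2 * M 0 1 = 2) : Good4 M := by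
  intro ξ h
  have h2 := h ![1, 0]
  have h3 := h ![0, 1]
  rw [Matrix.det_fin_two]
  simp [dotProduct, Matrix.mulVec, Fin.sum_univ_two, hs] at h2 h3 ⊢
  rw [h0] at h2
  rw [h1] at h3
  generalize M 0 0 = a at *
  generalize M 0 1 = b at *
  generalize M 1 1 = c at *
  generalize ξ 0 = x at *
  generalize ξ 1 = y at *
  clear h hs
  have ha : a = 0 ∨ a = 2 := by clear h2 h3; revert a; decide
  have hc : c = 0 ∨ c = 2 := by clear h2 h3; revert c; decide
  have hb : b = 1 ∨ b = 3 := by clear h2 h3; revert b; decide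
  rcases ha with rfl | rfl <;> rcases hc with rfl | rfl <;> rcases hb with rfl | rfl <;>
    revert x y <;> decide

lemma zmod4_unit (a : ZMod 4) (h : 2 * a = 2) : IsUnit a := by
  have : ∀ a : ZMod 4, 2 * a = 2 → a * a = 1 := by decide
  exact IsUnit.of_mul_eq_one _ (this a h)

lemma zmod4_cases : ∀ a : ZMod 4, 2 * a = 2 ∨ 2 * a = 0 := by decide

lemma good4_all (k : ℕ) : ∀ (ι : Type) [Fintype ι] [DecidableEq ι] (M : Matrix ι ι (ZMod 4)),
    Fintype.card ι = k → M.IsSymm → IsUnit M.det → Good4 M := by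
  induction k using Nat.strong_induction_on with
  | _ k IH =>
  intro ι _ _ M hk hM hu
  by_cases hd : ∃ i, 2 * M i i = 2
  · obtain ⟨i, hi⟩ := hd
    let f : Unit ⊕ {j // j ≠ i} → ι := Sum.elim (fun _ => i) (fun j => j.1)
    have hf : Function.Bijective f := by
      constructor
      · rintro (a | ⟨a, ha⟩) (b | ⟨b, hb⟩) <;> simp [f] <;> grind
      · intro j
        by_cases hj : j = i
        · exact ⟨Sum.inl (), hj.symm⟩
        · exact ⟨Sum.inr ⟨j, hj⟩, rfl⟩
    let e := Equiv.ofBijective f hf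
    have hc : Fintype.card {j // j ≠ i} < k := by
      have := Fintype.card_congr e
      rw [Fintype.card_sum, hk, Fintype.card_unit] at this
      omega
    apply good4_reindex e
    have hi' : 2 * (M.submatrix e e).toBlocks₁₁ () () = 2 := hi
    apply good4_block _ (hM.submatrix e) (by rwa [Matrix.det_submatrix_equiv_self])
    · rw [Matrix.det_unique]
      exact zmod4_unit _ hi'
    · exact good4_one _ hi'
    · intro S hS hSu
      exact IH _ hc _ S rfl hS hSu
  · have hd' : ∀ i, 2 * M i i = 0 := fun i =>
      (zmod4_cases (M i i)).resolve_left fun h => hd ⟨i, h⟩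
    rcases isEmpty_or_nonempty ι with hE | ⟨⟨i⟩⟩
    · intro ξ _
      simp
    have hj : ∃ j, 2 * M i j = 2 := by
      by_contra hno
      push Not at hno
      have h0 : ∀ j, 2 * M i j = 0 := fun j => (zmod4_cases (M i j)).resolve_left (hno j)
      have h1 : (M * M.adjugate) i i = M.det := by simp [Matrix.mul_adjugate]
      have h2 : 2 * M.det = 0 := by
        rw [← h1, Matrix.mul_apply, Finset.mul_sum]
        apply Finset.sum_eq_zero
        intro j _
        rw [← mul_assoc, h0, zero_mul]
      have h3 := hu.mul_left_eq_zero.mp h2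
      exact absurd h3 (by decide)
    obtain ⟨j, hj⟩ := hj
    have hij : i ≠ j := by
      rintro rfl
      exact hd ⟨_, hj⟩
    let f : Fin 2 ⊕ {l // l ≠ i ∧ l ≠ j} → ι := Sum.elim ![i, j] (fun j => j.1)
    have hf : Function.Bijective f := by
      constructor
      · rintro (a | ⟨a, ha⟩) (b | ⟨b, hb⟩)
        · fin_cases a <;> fin_cases b <;> simp [f] <;> grind
        · fin_cases a <;> simp [f] <;> grind
        · fin_cases b <;> simp [f] <;> grind
        · simp [f]
      · intro l
        by_cases hl : l = i
        · exact ⟨Sum.inl 0, hl.symm⟩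
        by_cases hl' : l = j
        · exact ⟨Sum.inl 1, hl'.symm⟩
        · exact ⟨Sum.inr ⟨l, hl, hl'⟩, rfl⟩
    let e := Equiv.ofBijective f hf
    have hc : Fintype.card {l // l ≠ i ∧ l ≠ j} < k := by
      have := Fintype.card_congr e
      rw [Fintype.card_sum, hk, Fintype.card_fin] at this
      omega
    apply good4_reindex e
    have h00 : 2 * (M.submatrix e e).toBlocks₁₁ 0 0 = 0 := hd' i
    have h11 : 2 * (M.submatrix e e).toBlocks₁₁ 1 1 = 0 := hd' j
    have h01 : 2 * (M.submatrix e e).toBlocks₁₁ 0 1 = 2 := hj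
    have h10 : (M.submatrix e e).toBlocks₁₁ 1 0 = (M.submatrix e e).toBlocks₁₁ 0 1 :=
      hM.apply i j
    apply good4_block _ (hM.submatrix e) (by rwa [Matrix.det_submatrix_equiv_self])
    · rw [Matrix.det_fin_two, h10]
      apply zmod4_unit
      generalize (M.submatrix e e).toBlocks₁₁ 0 0 = a at *
      generalize (M.submatrix e e).toBlocks₁₁ 1 1 = b at *
      generalize (M.submatrix e e).toBlocks₁₁ 0 1 = c at *
      clear h10
      have h3 : 2 * (c * c) = 2 := by
        clear h00 h11
        revert c
        decide
      have h4 : (-2 : ZMod 4) = 2 := by decide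
      linear_combination b * h00 - h3 + h4
    · exact good4_two _ h00 h11 h10 h01
    · intro S hS hSu
      exact IH _ hc _ S rfl hS hSu

lemma char_norm_mod4 {n : ℕ} (P : Matrix (Fin n) (Fin n) ℤ) (hsymm : P.IsSymm)
    (hdet : P.det = 1) (ξ : Fin n → ℤ)
    (hξ : ∀ x : Fin n → ℤ, 2 ∣ (x ⬝ᵥ P *ᵥ ξ - x ⬝ᵥ P *ᵥ x)) :
    (4 : ℤ) ∣ ξ ⬝ᵥ P *ᵥ ξ - n := by
  let φ : ℤ →+* ZMod 4 := Int.castRingHom (ZMod 4)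
  have hφ : ∀ x y : Fin n → ℤ, (φ ∘ x) ⬝ᵥ (P.map φ) *ᵥ (φ ∘ y) = φ (x ⬝ᵥ P *ᵥ y) := by
    intro x y
    simp [dotProduct, Matrix.mulVec, map_sum]
  have hd : (P.map φ).det = 1 := by
    have := RingHom.map_det φ P
    rw [hdet, map_one] at this
    exact this.symm
  have hg := good4_all n (Fin n) (P.map φ) (by simp) (hsymm.map φ) (by rw [hd]; exact isUnit_one)
    (φ ∘ ξ) (by
      intro x
      obtain ⟨y, rfl⟩ : ∃ y : Fin n → ℤ, φ ∘ y = x :=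
        ⟨fun i => (ZMod.intCast_surjective (x i)).choose,
          funext fun i => (ZMod.intCast_surjective (x i)).choose_spec⟩
      rw [hφ, hφ]
      obtain ⟨c, hc⟩ := hξ y
      have h4 : (4 : ZMod 4) = 0 := by decide
      have : φ (y ⬝ᵥ P *ᵥ ξ) - φ (y ⬝ᵥ P *ᵥ y) = 2 * φ c := by
        rw [← map_sub, hc, map_mul]; simp
      linear_combination 2 * this + φ c * h4)
  rw [hφ, hd, Fintype.card_fin] at hg
  have h5 : ((ξ ⬝ᵥ P *ᵥ ξ - n : ℤ) : ZMod 4) = 0 := by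
    push_cast
    have : φ (ξ ⬝ᵥ P *ᵥ ξ) = ((ξ ⬝ᵥ P *ᵥ ξ : ℤ) : ZMod 4) := rfl
    rw [← this, hg]
    ring
  exact_mod_cast (ZMod.intCast_zmod_eq_zero_iff_dvd _ 4).mp h5

section abstractPart

variable {V : Type} [AddCommGroup V] (B : V →ₗ[ℤ] V →ₗ[ℤ] ℤ) (E : Set V)

/-- The facts about `Exc L` used in the counting argument. -/
structure ExcData (B : V →ₗ[ℤ] V →ₗ[ℤ] ℤ) (E : Set V) : Prop where
  symm : ∀ x y, B x y = B y x
  pos : ∀ x, x ≠ 0 → 0 < B x x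
  no1 : ∀ x, B x x ≠ 1
  five : ∀ x ∈ E, B x x = 5
  neg : ∀ x ∈ E, -x ∈ E
  two : ∀ x ∈ E, ∀ y ∈ E, ∃ v : V, y = x - (2 : ℤ) • v

variable {B E}

lemma ExcData.cases (h : ExcData B E) {x y : V} (hx : x ∈ E) (hy : y ∈ E) :
    (y = x ∧ B x y = 5) ∨ (y = -x ∧ B x y = -5) ∨
    (B x y = 1 ∧ ∃ v, B v v = 2 ∧ B x v = 2 ∧ y = x - (2 : ℤ) • v) ∨
    (B x y = -1 ∧ ∃ v, B v v = 2 ∧ B x v = 2 ∧ -y = x - (2 : ℤ) • v) := by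
  obtain ⟨v, rfl⟩ := h.two x hx y hy
  have h5 := h.five x hx
  have h5' := h.five _ hy
  have hs := h.symm v x
  have e1 : B x (x - (2 : ℤ) • v) = 5 - 2 * B x v := by
    rw [map_sub, map_smul, h5, smul_eq_mul]
  have e2 : B x v = B v v := by
    simp only [map_sub, map_smul, LinearMap.sub_apply, LinearMap.smul_apply, smul_eq_mul] at h5'
    linarith
  have e3 : B (x - v) (x - v) = 5 - B v v := by
    simp only [map_sub, LinearMap.sub_apply]
    linarith
  have n1 := h.no1 v
  have n2 := h.no1 (x - v)
  by_cases hv : v = 0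
  · left; subst hv; simp [h5]
  by_cases hw : x - v = 0
  · right; left
    have : v = x := (sub_eq_zero.mp hw).symm
    subst this
    refine ⟨by module, ?_⟩
    rw [e1, h5]; norm_num
  have p1 := h.pos v hv
  have p2 := h.pos _ hw
  rw [e3] at n2 p2
  right; right
  have : B v v = 2 ∨ B v v = 3 := by omega
  rcases this with h2 | h3
  · left
    exact ⟨by omega, v, h2, by omega, rfl⟩
  · right
    refine ⟨by omega, x - v, by omega, ?_, by module⟩
    rw [map_sub]; omega

lemma ExcData.pair (h : ExcData B E) {x y z : V} (hx : x ∈ E) (hy : y ∈ E) (hz : z ∈ E)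
    (hxy : 0 < B x y) (hxz : 0 < B x z) (hne : y ≠ z) : B y z = 1 := by
  have h5 := h.five x hx
  rcases h.cases hx hy with ⟨rfl, _⟩ | ⟨_, _⟩ | ⟨_, v, hv, hxv, ev⟩ | ⟨_, _⟩
  · rcases h.cases hy hz with ⟨rfl, _⟩ | ⟨_, _⟩ | ⟨h1, _⟩ | ⟨_, _⟩
    · exact absurd rfl hne
    · omega
    · exact h1
    · omega
  · omega
  · rcases h.cases hx hz with ⟨rfl, _⟩ | ⟨_, _⟩ | ⟨_, w, hw, hxw, ew⟩ | ⟨_, _⟩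
    · rw [h.symm]; assumption
    · omega
    · have e : B y z = -3 + 4 * B v w := by
        have := h.symm v x
        rw [ev, ew]
        simp only [map_sub, map_smul, LinearMap.sub_apply, LinearMap.smul_apply, smul_eq_mul]
        linarith
      rcases h.cases hy hz with ⟨h1, _⟩ | ⟨_, _⟩ | ⟨h1, _⟩ | ⟨_, _⟩
      · exact absurd h1.symm hne
      · omega
      · exact h1
      · omega
    · omega
  · omega

lemma ExcData.linInd (h : ExcData B E) {x : V} (hx : x ∈ E) :
    LinearIndependent ℤ (Subtype.val : {y // y ∈ E ∧ 0 < B x y} → V) := by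
  classical
  rw [linearIndependent_iff']
  intro s g hg
  have key : ∀ j ∈ s, (∑ i ∈ s, g i) + 4 * g j = 0 := by
    intro j hj
    have h1 : ∑ i ∈ s, g i * B i.1 j.1 = 0 := by
      have := congrArg (fun w => B w j.1) hg
      simpa [map_sum, LinearMap.sum_apply] using this
    have h2 : ∀ i ∈ s, g i * B i.1 j.1 = g i + (if i = j then 4 * g i else 0) := by
      intro i _
      split_ifs with hij
      · subst hij
        rw [h.five _ i.2.1]; ring
      · rw [h.pair hx i.2.1 j.2.1 i.2.2 j.2.2 (fun h => hij (Subtype.ext h))]; ring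
    rw [Finset.sum_congr rfl h2, Finset.sum_add_distrib, Finset.sum_ite_eq' s j] at h1
    simpa [hj] using h1
  have hS : ((s.card : ℤ) + 4) * ∑ i ∈ s, g i = 0 := by
    have := Finset.sum_eq_zero key
    rw [Finset.sum_add_distrib, ← Finset.mul_sum, Finset.sum_const, nsmul_eq_mul] at this
    linarith
  have hS' : ∑ i ∈ s, g i = 0 := by
    rcases mul_eq_zero.mp hS with h | h
    · omega
    · exact h
  intro i hi
  have := key i hi
  omega

lemma ExcData.card [Module.Finite ℤ V] [Module.Free ℤ V] (h : ExcData B E) {x : V} (hx : x ∈ E) :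
    ∃ m : ℕ, 1 ≤ m ∧ m ≤ Module.finrank ℤ V ∧ Nat.card E = 2 * m := by
  have hl := h.linInd hx
  have hfin : Finite {y // y ∈ E ∧ 0 < B x y} := hl.finite
  let T : Set V := {y | y ∈ E ∧ 0 < B x y}
  have hT : T.Finite := hfin
  have hxT : x ∈ T := ⟨hx, by rw [h.five x hx]; norm_num⟩
  have hE : E = T ∪ (fun y => -y) '' T := by
    ext y
    constructor
    · intro hy
      by_cases hp : 0 < B x y
      · exact Or.inl ⟨hy, hp⟩
      · right
        refine ⟨-y, ⟨h.neg y hy, ?_⟩, neg_neg y⟩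
        rw [map_neg]
        rcases h.cases hx hy with ⟨_, _⟩ | ⟨_, _⟩ | ⟨_, _⟩ | ⟨_, _⟩ <;> omega
    · rintro (hy | ⟨z, hz, rfl⟩)
      · exact hy.1
      · exact h.neg z hz.1
  have hdis : Disjoint T ((fun y => -y) '' T) := by
    rw [Set.disjoint_left]
    rintro y hy ⟨z, hz, rfl⟩
    have h1 := hy.2
    have h2 := hz.2
    simp only [map_neg] at h1
    omega
  refine ⟨T.ncard, (Set.ncard_pos hT).mpr ⟨x, hxT⟩, ?_, ?_⟩
  · have := Fintype.ofFinite {y // y ∈ E ∧ 0 < B x y}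
    have := hl.fintype_card_le_finrank
    rw [← Nat.card_eq_fintype_card] at this
    exact this
  · rw [Nat.card_coe_set_eq]
    conv_lhs => rw [hE]
    rw [Set.ncard_union_eq hdis hT (hT.image _), Set.ncard_image_of_injective _ neg_injective]
    ring

end abstractPart

lemma weylPM_refl {n : ℕ} (P : Matrix (Fin n) (Fin n) ℤ) (α : Fin n → ℤ)
    (hα : α ⬝ᵥ P *ᵥ α = 2) : ∃ σ ∈ weylPM P, ∀ x, σ x = x - (x ⬝ᵥ P *ᵥ α) • α := by
  let f : Module.Dual ℤ (Fin n → ℤ) := (Matrix.toBilin' P).flip α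
  have hf : ∀ x, f x = x ⬝ᵥ P *ᵥ α := fun x => Matrix.toBilin'_apply' P x α
  have h2 : f α = 2 := by rw [hf, hα]
  have hr : ∀ x, Module.reflection h2 x = x - (x ⬝ᵥ P *ᵥ α) • α := by
    intro x
    rw [Module.reflection_apply, hf]
  exact ⟨Module.reflection h2, Subgroup.subset_closure (Or.inl ⟨α, hα, hr⟩), hr⟩

lemma weylPM_neg {n : ℕ} (P : Matrix (Fin n) (Fin n) ℤ) :
    ∃ σ ∈ weylPM P, ∀ x, σ x = -x :=
  ⟨LinearEquiv.neg ℤ, Subgroup.subset_closure (Or.inr fun _ => rfl), fun _ => rfl⟩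

/-- Let `L = ℤⁿ` (Gram matrix `P`) be an exceptional unimodular lattice with
`n ≡ 5 (mod 8)` and no vector of norm 1. Then `|Exc L| = 2m` for some `1 ≤ m ≤ n`, and
`W(L)^±` acts transitively on `Exc L`, the set of characteristic vectors of norm `< 8`. -/
theorem exceptional_vectors_card_and_weylPM_transitive
    {n : ℕ} (P : Matrix (Fin n) (Fin n) ℤ) (hsymm : P.IsSymm)
    (hpos : ∀ x : Fin n → ℤ, x ≠ 0 → 0 < x ⬝ᵥ P *ᵥ x) (hdet : P.det = 1)
    (h5 : n % 8 = 5) (hno1 : ∀ x : Fin n → ℤ, x ⬝ᵥ P *ᵥ x ≠ 1)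
    (hexc : ∃ ξ : Fin n → ℤ, (∀ x : Fin n → ℤ, 2 ∣ (x ⬝ᵥ P *ᵥ ξ - x ⬝ᵥ P *ᵥ x)) ∧
      ξ ⬝ᵥ P *ᵥ ξ < 8) :
    (∃ m : ℕ, 1 ≤ m ∧ m ≤ n ∧
      Nat.card {ξ : Fin n → ℤ //
        (∀ x : Fin n → ℤ, 2 ∣ (x ⬝ᵥ P *ᵥ ξ - x ⬝ᵥ P *ᵥ x)) ∧ ξ ⬝ᵥ P *ᵥ ξ < 8}
        = 2 * m) ∧
    (∀ v v' : Fin n → ℤ,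
      (∀ x : Fin n → ℤ, 2 ∣ (x ⬝ᵥ P *ᵥ v - x ⬝ᵥ P *ᵥ x)) → v ⬝ᵥ P *ᵥ v < 8 →
      (∀ x : Fin n → ℤ, 2 ∣ (x ⬝ᵥ P *ᵥ v' - x ⬝ᵥ P *ᵥ x)) → v' ⬝ᵥ P *ᵥ v' < 8 →
      ∃ σ ∈ weylPM P, σ v = v') := by
  let B : (Fin n → ℤ) →ₗ[ℤ] (Fin n → ℤ) →ₗ[ℤ] ℤ := Matrix.toBilin' P
  have hB : ∀ x y, B x y = x ⬝ᵥ P *ᵥ y := fun x y => Matrix.toBilin'_apply' P x y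
  let E : Set (Fin n → ℤ) := {ξ | (∀ x : Fin n → ℤ, 2 ∣ (x ⬝ᵥ P *ᵥ ξ - x ⬝ᵥ P *ᵥ x)) ∧
    ξ ⬝ᵥ P *ᵥ ξ < 8}
  have hD : ExcData B E := by
    refine ⟨?_, ?_, ?_, ?_, ?_, ?_⟩
    · intro x y
      rw [hB, hB, Matrix.dotProduct_mulVec, ← Matrix.mulVec_transpose, hsymm.eq, dotProduct_comm]
    · intro x hx
      rw [hB]; exact hpos x hx
    · intro x
      rw [hB]; exact hno1 x
    · rintro x ⟨hx, hx8⟩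
      have h4 := char_norm_mod4 P hsymm hdet x hx
      have h1 := hno1 x
      have h0 : 0 ≤ x ⬝ᵥ P *ᵥ x := by
        by_cases h : x = 0
        · simp [h]
        · exact (hpos x h).le
      rw [hB]
      omega
    · rintro x ⟨hx, hx8⟩
      refine ⟨fun y => ?_, ?_⟩
      · have := hx (-y)
        simpa [Matrix.mulVec_neg] using this
      · simpa [Matrix.mulVec_neg] using hx8
    · rintro x ⟨hx, _⟩ y ⟨hy, _⟩
      have h1 : ∀ i, (2 : ℤ) ∣ (P *ᵥ (x - y)) i := by
        intro i
        have e := dvd_sub (hx (Pi.single i 1)) (hy (Pi.single i 1))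
        rw [sub_sub_sub_cancel_right, single_one_dotProduct, single_one_dotProduct] at e
        rw [Matrix.mulVec_sub, Pi.sub_apply]
        exact e
      choose w hw using h1
      have hw' : P *ᵥ (x - y) = (2 : ℤ) • w := funext hw
      refine ⟨P.adjugate *ᵥ w, ?_⟩
      have h3 : P.adjugate *ᵥ (P *ᵥ (x - y)) = x - y := by
        rw [Matrix.mulVec_mulVec, Matrix.adjugate_mul, hdet, one_smul, Matrix.one_mulVec]
      rw [← Matrix.mulVec_smul, ← hw', h3]
      abel
  constructor
  · obtain ⟨ξ, hξ⟩ := hexc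
    obtain ⟨m, h1, h2, h3⟩ := hD.card (x := ξ) hξ
    rw [Module.finrank_fin_fun] at h2
    exact ⟨m, h1, h2, h3⟩
  · intro v v' hv hv8 hv' hv8'
    obtain ⟨ν, hν, hνx⟩ := weylPM_neg P
    rcases hD.cases (x := v) (y := v') ⟨hv, hv8⟩ ⟨hv', hv8'⟩ with
      ⟨rfl, _⟩ | ⟨rfl, _⟩ | ⟨_, α, hα, hvα, e⟩ | ⟨_, α, hα, hvα, e⟩
    · exact ⟨1, one_mem _, rfl⟩
    · exact ⟨ν, hν, hνx v⟩
    · rw [hB] at hα hvα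
      obtain ⟨σ, hσ, hσx⟩ := weylPM_refl P α hα
      exact ⟨σ, hσ, by rw [hσx, hvα, e]⟩
    · rw [hB] at hα hvα
      obtain ⟨σ, hσ, hσx⟩ := weylPM_refl P α hα
      refine ⟨ν * σ, mul_mem hν hσ, ?_⟩
      rw [LinearEquiv.mul_apply, hσx, hvα, ← e, hνx, neg_neg]
end

section
/- Let L be an exceptional unimodular integral lattice of rank n with n ≡ 5 (mod 8) whose every nonzero vector has norm ≥ 3 (no vectors of norm 1 or 2). Then L has exactly 2 characteristic vectors of norm < 8. -/
open Matrix

section Helpers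
open Complex Filter Topology

lemma summ_gauss' (A b : ℂ) (hA : 0 < A.re) :
    Summable (fun n : ℤ => cexp (-Real.pi * A * n ^ 2 + 2 * Real.pi * b * n)) := by
  have := (summable_jacobiTheta₂_term_iff (-I * b) (I * A)).2 (by simpa using hA)
  refine this.congr fun n => ?_
  rw [jacobiTheta₂_term]
  congr 1
  linear_combination (Real.pi * A * n^2 - 2 * Real.pi * b * n) * I_mul_I

lemma summ_gauss : Summable (fun n : ℤ => Real.exp (-Real.pi * (n:ℝ)^2)) := by
  have h2 := (summ_gauss' 1 0 (by simp)).norm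
  refine h2.congr fun n => ?_
  rw [Complex.norm_exp]
  congr 1
  have : (-Real.pi * 1 * (n:ℂ) ^ 2 + 2 * Real.pi * 0 * n) = ((-Real.pi * (n:ℝ)^2 : ℝ) : ℂ) := by
    push_cast
    ring
  rw [this, ofReal_re]

lemma lim_gauss (κ : ℝ) (hκ : 0 < κ) (u : ℤ → ℂ) (hu : ∀ n, ‖u n‖ ≤ 1) (h0 : u 0 = 1) :
    Tendsto (fun s : ℝ => ∑' n : ℤ, cexp ((-Real.pi * (s * κ) * (n:ℝ)^2 : ℝ)) * u n) atTop (𝓝 1) := by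
  have key := tendsto_tsum_of_dominated_convergence (𝓕 := (atTop : Filter ℝ))
    (f := fun (s : ℝ) (n : ℤ) => cexp ((-Real.pi * (s * κ) * (n:ℝ)^2 : ℝ)) * u n)
    (g := fun n => if n = 0 then 1 else 0) summ_gauss ?_ ?_
  · simpa using key
  · intro n
    by_cases hn : n = 0
    · subst hn; simp [h0]
    · simp only [hn, if_false]
      have : Tendsto (fun s : ℝ => Real.exp (-Real.pi * (s * κ) * (n:ℝ)^2)) atTop (𝓝 0) := by
        refine Real.tendsto_exp_atBot.comp ?_
        have hpos : 0 < Real.pi * κ * (n:ℝ)^2 := by positivity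
        have := (tendsto_id (α := ℝ) (x := atTop)).const_mul_atTop hpos
        have := tendsto_neg_atTop_atBot.comp this
        refine this.congr fun s => ?_
        simp; ring
      have h2 : Tendsto (fun s : ℝ => cexp ((-Real.pi * (s * κ) * (n:ℝ)^2 : ℝ))) atTop (𝓝 0) := by
        have := (continuous_ofReal.tendsto 0).comp this
        simpa [Function.comp_def] using this
      simpa using h2.mul_const (u n)
  · filter_upwards [eventually_ge_atTop (1/κ)] with s hs n
    rw [norm_mul, ← ofReal_exp, Complex.norm_real, Real.norm_eq_abs, Real.abs_exp]
    have h1 : 1 ≤ s * κ := by rwa [div_le_iff₀ hκ] at hs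
    calc _ ≤ Real.exp (-Real.pi * (s * κ) * (n:ℝ)^2) * 1 := by gcongr; exact hu n
      _ ≤ _ := by
        rw [mul_one]
        apply Real.exp_le_exp.2
        have : 0 ≤ Real.pi * (n:ℝ)^2 := by positivity
        nlinarith


lemma poisson1 (w : ℂ) (hw : 0 < w.re) (x : ℝ) :
    ∑' n : ℤ, cexp (-Real.pi / w * (n + x)^2) =
      w ^ (1/2 : ℂ) * ∑' n : ℤ, cexp (-Real.pi * w * n^2) * cexp (-(2 * Real.pi * I * x * n)) := by
  have h := Complex.tsum_exp_neg_quadratic hw (-I * x)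
  have hw0 : w ≠ 0 := by rintro rfl; simp at hw
  have hw1 : w ^ (1/2 : ℂ) ≠ 0 := by simp [hw0]
  have e1 : ∀ n : ℤ, cexp (-Real.pi * w * n^2) * cexp (-(2 * Real.pi * I * x * n)) =
      cexp (-Real.pi * w * n ^ 2 + 2 * Real.pi * (-I * x) * n) := by
    intro n; rw [← Complex.exp_add]; congr 1; ring
  have e2 : ∀ n : ℤ, ((n:ℂ) + I * (-I * x)) = n + x := by
    intro n; linear_combination (-x:ℂ) * I_mul_I
  simp_rw [e1, h, e2]
  field_simp

lemma tsum_residue (N : ℕ) [NeZero N] (f : ℤ → ℂ) (hf : Summable f) :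
    ∑' k, f k = ∑ r : Fin N, ∑' m : ℤ, f (N * m + (r : ℕ)) := by
  have h1 : Summable (fun p : ℤ × Fin N => f ((Int.divModEquiv N).symm p)) :=
    ((Int.divModEquiv N).symm.summable_iff (f := f)).2 hf
  rw [← (Int.divModEquiv N).symm.tsum_eq f]
  have h2 : Summable (fun p : Fin N × ℤ => f ((Int.divModEquiv N).symm p.swap)) :=
    ((Equiv.prodComm (Fin N) ℤ).summable_iff
      (f := fun p : ℤ × Fin N => f ((Int.divModEquiv N).symm p))).2 h1
  rw [← (Equiv.prodComm (Fin N) ℤ).tsum_eq]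
  have := h2.tsum_prod
  simp only [Equiv.prodComm_apply]
  rw [this, tsum_fintype]
  simp [Int.divModEquiv, mul_comm]

lemma exp_two_pi_int (x : ℂ) (m : ℤ) (h : x = 2 * Real.pi * I * m) : cexp x = 1 := by
  rw [h, Complex.exp_eq_one_iff]; exact ⟨m, by ring⟩

lemma exp_eq_of_sub (x y : ℂ) (m : ℤ) (h : x - y = 2 * Real.pi * I * m) : cexp x = cexp y := by
  have := exp_two_pi_int _ m h
  rw [Complex.exp_sub, div_eq_one_iff_eq (Complex.exp_ne_zero _)] at this
  exact this

/-- the basic phase -/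
noncomputable def ph (a : ℕ) (c : ℤ) (k : ℤ) : ℂ := cexp (Real.pi * I * ((k:ℂ)^2 + c * k) / a)

lemma even_qq (a c k : ℤ) (h : 2 ∣ c - a) : ∃ t : ℤ, a * k ^ 2 + c * k = 2 * t := by
  obtain ⟨d, hd⟩ := h
  obtain ⟨e, he⟩ := Int.even_mul_succ_self k
  exact ⟨a * e + d * k, by linear_combination a * he + k * hd⟩

lemma ph_period (a : ℕ) (ha : 0 < a) (c : ℤ) (h : 2 ∣ c - a) (k m : ℤ) :
    ph a c (a * m + k) = ph a c k := by
  obtain ⟨t, ht⟩ := even_qq a c m h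
  refine exp_eq_of_sub _ _ (t + m * k) ?_
  have ht' : (a:ℂ) * m ^ 2 + c * m = 2 * t := by exact_mod_cast ht
  have : (a:ℂ) ≠ 0 := by exact_mod_cast ha.ne'
  push_cast
  field_simp
  linear_combination (a:ℂ) * ht'

lemma cpow_scale (s : ℝ) (hs : 0 < s) (z : ℂ) (hz : z ≠ 0) (r : ℂ) :
    ((s:ℂ) * z) ^ r = (s:ℂ) ^ r * z ^ r := by
  have hs' : (s:ℂ) ≠ 0 := by exact_mod_cast hs.ne'
  rw [cpow_def_of_ne_zero (mul_ne_zero hs' hz), cpow_def_of_ne_zero hs', cpow_def_of_ne_zero hz,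
    log_ofReal_mul hs hz, ← Complex.exp_add, ofReal_log hs.le]
  congr 1; ring

lemma gauss_eq (a N : ℕ) (ha : 0 < a) [NeZero N] (hN : a ∣ N) (c : ℤ) (h : 2 ∣ c - a) (s : ℝ)
    (hs : 0 < s) :
    ∑ r : Fin N, ph a c (r : ℕ) * (((a^2/N^2 : ℝ) : ℂ) - I * a / (N^2 * s)) ^ (1/2:ℂ) *
      (∑' n : ℤ, cexp ((-Real.pi * (s * (a^2/N^2)) * (n:ℝ)^2 : ℝ)) *
        cexp ((Real.pi * a * n^2 / N^2 - 2 * Real.pi * (r : ℕ) / N * n : ℝ) * I)) =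
    1 / (1 / (1 / (s:ℂ) + I * a)) ^ (1/2 : ℂ) * cexp (-(Real.pi * I * c^2 / (4 * a))) *
      (∑' n : ℤ, cexp ((-Real.pi * (s * 1) * (n:ℝ)^2 : ℝ)) *
        cexp ((Real.pi * c / a * n : ℝ) * I)) := by
  have hN0 : 0 < N := Nat.pos_of_ne_zero (NeZero.ne N)
  have hac : (a:ℂ) ≠ 0 := by exact_mod_cast ha.ne'
  have hNc : (N:ℂ) ≠ 0 := by exact_mod_cast hN0.ne'
  have hsc : (s:ℂ) ≠ 0 := by exact_mod_cast hs.ne'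
  have hs12 : (s:ℂ) ^ (1/2:ℂ) ≠ 0 := by simp [hsc]
  set D : ℂ := 1 / (s:ℂ) + I * a with hD
  have hDre : 0 < D.re := by
    have : D = ((1/s : ℝ) : ℂ) + (a:ℝ) * I := by rw [hD]; push_cast; ring
    rw [this]; simp; exact hs
  have hD0 : D ≠ 0 := by intro h0; simp [h0] at hDre
  have hAre : 0 < (1 / D).re := by
    rw [one_div, Complex.inv_re]
    exact div_pos hDre (Complex.normSq_pos.2 hD0)
  have hP := Complex.tsum_exp_neg_quadratic hAre (I * c / (2 * a))
  have hS := summ_gauss' (1 / D) (I * c / (2 * a)) hAre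
  -- right side
  have hR : ∀ n : ℤ, cexp (-Real.pi / (1 / D) * (n + I * (I * c / (2 * a)))^2) =
      cexp (-(Real.pi * I * c^2 / (4 * a))) *
        cexp (-Real.pi / (s:ℂ) * (n + ((-(c / (2 * a)) : ℝ) : ℂ)) ^ 2) := by
    intro n
    rw [← Complex.exp_add]
    obtain ⟨t, ht⟩ := even_qq a (-c) n (by omega)
    refine exp_eq_of_sub _ _ (-t) ?_
    have ht' : (a:ℂ) * n ^ 2 + (-c) * n = 2 * t := by exact_mod_cast ht
    have e1 : (n:ℂ) + I * (I * c / (2 * a)) = n - c / (2 * a) := by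
      linear_combination ((c:ℂ) / (2 * a)) * I_mul_I
    rw [e1, hD]
    push_cast
    have : (a:ℂ) * (n - c / (2*a))^2 = 2 * t + c^2/(4*a) := by
      rw [← ht']; field_simp; ring
    have e2 : -Real.pi / (1 / (1 / (s:ℂ) + I * a)) * ((n:ℂ) - c / (2 * a)) ^ 2 =
      -Real.pi / s * ((n:ℂ) - c / (2 * a)) ^ 2 - Real.pi * I * (a * ((n:ℂ) - c / (2 * a)) ^ 2) := by
      rw [div_div_eq_mul_div, div_one]; ring
    rw [e2, this]
    ring
  simp_rw [hR] at hP
  rw [tsum_mul_left, poisson1 s (by simpa using hs)] at hP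
  -- left side
  rw [tsum_residue N _ hS] at hP
  obtain ⟨q, hq⟩ := hN
  set z : ℂ := ((a^2/N^2 : ℝ) : ℂ) - I * a / (N^2 * s) with hz
  have hzre : 0 < z.re := by
    have : z = ((a^2/N^2 : ℝ) : ℂ) + ((-(a / (N^2 * s)) : ℝ) : ℂ) * I := by
      rw [hz]; push_cast; ring
    rw [this]
    simp only [add_re, mul_re, ofReal_re, I_re, I_im, ofReal_im]
    have : (0:ℝ) < a^2/N^2 := by positivity
    linarith
  have hz0 : z ≠ 0 := by intro h0; simp [h0] at hzre
  have hwre : 0 < ((s:ℂ) * z).re := by simpa using mul_pos hs hzre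
  have hzD : D * (s * z * N^2) * I = a * D - a * (s * z * N^2) := by
    have hh : s * z * N^2 = s * a^2 - I * a := by rw [hz]; push_cast; field_simp
    rw [hh, hD]; field_simp
    ring_nf
    simp only [I_sq, I_pow_three]
    ring
  have hL : ∀ (r : Fin N) (m : ℤ), cexp (-Real.pi * (1 / D) * ((N * m + (r:ℕ) : ℤ) : ℂ) ^ 2 +
      2 * Real.pi * (I * c / (2 * a)) * ((N * m + (r:ℕ) : ℤ) : ℂ)) =
      ph a c (r : ℕ) * cexp (-Real.pi / (s * z) * (m + (((r:ℕ) / N : ℝ) : ℂ)) ^ 2) := by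
    intro r m
    have hp := ph_period a ha c h ((r:ℕ):ℤ) (q * m)
    have : (a:ℤ) * (q * m) + (r:ℕ) = N * m + (r:ℕ) := by
      have : (N:ℤ) = a * q := by exact_mod_cast hq
      rw [this]; ring
    rw [this] at hp
    rw [← hp, ph, ← Complex.exp_add]
    congr 1
    have e3 : (((N * m + (r:ℕ) : ℤ) : ℂ)) = N * (m + (((r:ℕ) / N : ℝ) : ℂ)) := by
      push_cast; field_simp
    rw [e3]
    generalize ((m:ℂ) + (((r:ℕ) / N : ℝ) : ℂ)) = y
    have e4 : 1 / (s * z) = N^2 * (1 / D + I / a) := by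
      field_simp
      linear_combination -hzD
    have e5 : -Real.pi / (s * z) * y^2 = - Real.pi * (1 / (s * z)) * y^2 := by ring
    rw [e5, e4]
    field_simp
    ring
  simp_rw [hL] at hP
  have hP2 := hP
  simp_rw [tsum_mul_left, poisson1 (s * z) hwre, cpow_scale s hs z hz0] at hP2
  have key : ∀ x y : ℂ, (s:ℂ) ^ (1/2:ℂ) * x = (s:ℂ) ^ (1/2:ℂ) * y → x = y :=
    fun x y hxy => mul_left_cancel₀ hs12 hxy
  apply key
  rw [Finset.mul_sum]
  convert hP2 using 1
  · refine Finset.sum_congr rfl fun r _ => ?_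
    have : ∀ n : ℤ, cexp (-Real.pi * (s * z) * n ^ 2) *
        cexp (-(2 * Real.pi * I * (((r:ℕ) / N : ℝ) : ℂ) * n)) =
        cexp ((-Real.pi * (s * (a^2/N^2)) * (n:ℝ)^2 : ℝ)) *
        cexp ((Real.pi * a * n^2 / N^2 - 2 * Real.pi * (r : ℕ) / N * n : ℝ) * I) := by
      intro n
      rw [← Complex.exp_add, ← Complex.exp_add]
      congr 1
      rw [hz]; push_cast; field_simp; ring
    simp_rw [this]
    ring
  · have : ∀ n : ℤ, cexp (-Real.pi * s * n ^ 2) *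
        cexp (-(2 * Real.pi * I * ((-(c / (2 * a)) : ℝ) : ℂ) * n)) =
        cexp ((-Real.pi * (s * 1) * (n:ℝ)^2 : ℝ)) *
        cexp ((Real.pi * c / a * n : ℝ) * I) := by
      intro n
      rw [← Complex.exp_add, ← Complex.exp_add]
      congr 1
      push_cast; field_simp
    simp_rw [this]
    ring

lemma gauss_lim (a N : ℕ) (ha : 0 < a) [NeZero N] (hN : a ∣ N) (c : ℤ) (h : 2 ∣ c - a) :
    ∑ r : Fin N, ph a c (r : ℕ) * ((a^2/N^2 : ℝ) : ℂ) ^ (1/2:ℂ) =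
    1 / (1 / (I * a)) ^ (1/2 : ℂ) * cexp (-(Real.pi * I * c^2 / (4 * a))) := by
  have hN0 : 0 < N := Nat.pos_of_ne_zero (NeZero.ne N)
  have hac : (a:ℂ) ≠ 0 := by exact_mod_cast ha.ne'
  have hinv : Tendsto (fun s : ℝ => (s:ℂ)⁻¹) atTop (𝓝 0) := by
    have := (continuous_ofReal.tendsto 0).comp tendsto_inv_atTop_zero
    simpa [Function.comp_def] using this
  have hκ : (0:ℝ) < a^2/N^2 := by positivity
  have h1 : Tendsto (fun s : ℝ => ∑ r : Fin N, ph a c (r : ℕ) *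
      (((a^2/N^2 : ℝ) : ℂ) - I * a / (N^2 * s)) ^ (1/2:ℂ) *
      (∑' n : ℤ, cexp ((-Real.pi * (s * (a^2/N^2)) * (n:ℝ)^2 : ℝ)) *
        cexp ((Real.pi * a * n^2 / N^2 - 2 * Real.pi * (r : ℕ) / N * n : ℝ) * I))) atTop
      (𝓝 (∑ r : Fin N, ph a c (r : ℕ) * ((a^2/N^2 : ℝ) : ℂ) ^ (1/2:ℂ) * 1)) := by
    refine tendsto_finsetSum _ fun r _ => ?_
    refine Tendsto.mul (Tendsto.const_mul _ ?_) (lim_gauss _ hκ _ ?_ ?_)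
    · refine Tendsto.cpow ?_ tendsto_const_nhds ?_
      · have := (hinv.const_mul (I * a / N^2)).const_sub ((a^2/N^2 : ℝ) : ℂ)
        simp only [mul_zero, sub_zero] at this
        refine this.congr fun s => ?_
        rw [← div_eq_mul_inv, div_div]
      · left; rw [ofReal_re]; exact hκ
    · intro n; rw [Complex.norm_exp_ofReal_mul_I]
    · simp
  have h2 : Tendsto (fun s : ℝ => 1 / (1 / (1 / (s:ℂ) + I * a)) ^ (1/2 : ℂ) *
      cexp (-(Real.pi * I * c^2 / (4 * a))) *
      (∑' n : ℤ, cexp ((-Real.pi * (s * 1) * (n:ℝ)^2 : ℝ)) *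
        cexp ((Real.pi * c / a * n : ℝ) * I))) atTop
      (𝓝 (1 / (1 / (I * a)) ^ (1/2 : ℂ) * cexp (-(Real.pi * I * c^2 / (4 * a))) * 1)) := by
    refine Tendsto.mul (Tendsto.mul_const _ ?_) (lim_gauss _ one_pos _ ?_ ?_)
    · refine Tendsto.div tendsto_const_nhds ?_ ?_
      · refine Tendsto.cpow ?_ tendsto_const_nhds ?_
        · refine Tendsto.div tendsto_const_nhds ?_ (by simp [hac])
          have := hinv.add_const (I * a)
          simpa using this
        · right
          simp [ha.ne']
      · simp [hac]
    · intro n; rw [Complex.norm_exp_ofReal_mul_I]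
    · simp
  have h3 := tendsto_nhds_unique (h1.congr' ?_) h2
  · simpa using h3
  · filter_upwards [eventually_gt_atTop 0] with s hs
    exact gauss_eq a N ha hN c h s hs

lemma gauss_final (a N : ℕ) (ha : 0 < a) [NeZero N] (hN : a ∣ N) (c : ℤ) (h : 2 ∣ c - a) :
    ∃ ρ : ℝ, 0 < ρ ∧ ∑ r : Fin N, ph a c (r : ℕ) =
      ρ * cexp (Real.pi * I / 4 * (1 - c^2 / a)) := by
  have hN0 : 0 < N := Nat.pos_of_ne_zero (NeZero.ne N)
  have hac : (a:ℂ) ≠ 0 := by exact_mod_cast ha.ne'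
  have hκ : (0:ℝ) < a^2/N^2 := by positivity
  have har : (0:ℝ) < 1 / a := by positivity
  have hl := gauss_lim a N ha hN c h
  rw [← Finset.sum_mul] at hl
  have e1 : (1 / (I * a) : ℂ) = ((1/a : ℝ) : ℂ) * (-I) := by
    push_cast; field_simp; simp
  have e2 : (-I : ℂ) ^ (1/2:ℂ) = cexp (-(Real.pi * I / 4)) := by
    rw [cpow_def_of_ne_zero (by simp), Complex.log_neg_I]; congr 1; ring
  have e3 : ∀ x : ℝ, 0 < x → (x:ℂ) ^ (1/2:ℂ) = ((x ^ (1/2:ℝ) : ℝ) : ℂ) := by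
    intro x hx; rw [ofReal_cpow hx.le]; simp
  rw [e1, cpow_scale _ har _ (by simp), e2, e3 _ hκ, e3 _ har] at hl
  have p1 := Real.rpow_pos_of_pos hκ (1/2)
  have p2 := Real.rpow_pos_of_pos har (1/2)
  refine ⟨1 / ((a^2/N^2 : ℝ) ^ (1/2:ℝ)) * (1 / ((1/a : ℝ) ^ (1/2:ℝ))), by positivity, ?_⟩
  have e4 : cexp (Real.pi * I / 4 * (1 - c^2 / a)) =
      1 / cexp (-(Real.pi * I / 4)) * cexp (-(Real.pi * I * c^2 / (4 * a))) := by
    rw [one_div, ← Complex.exp_neg, ← Complex.exp_add]; congr 1; field_simp; ring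
  rw [e4]
  generalize (a^2/N^2 : ℝ) ^ (1/2:ℝ) = X at *
  generalize (1/a : ℝ) ^ (1/2:ℝ) = Y at *
  have hX : (X:ℂ) ≠ 0 := by exact_mod_cast p1.ne'
  have hY : (Y:ℂ) ≠ 0 := by exact_mod_cast p2.ne'
  have hE := Complex.exp_ne_zero (-(Real.pi * I / 4))
  generalize cexp (-(Real.pi * I / 4)) = E at *
  rw [← mul_left_inj' hX, hl]
  push_cast
  field_simp


lemma gauss_zmod (a N : ℕ) (ha : 0 < a) [NeZero N] (hN : a ∣ N) (c : ℤ) (h : 2 ∣ c - a) :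
    ∃ ρ : ℝ, 0 < ρ ∧ ∑ r : ZMod N, ph a c (r.val : ℕ) =
      ρ * cexp (Real.pi * I / 4 * (1 - c^2 / a)) := by
  obtain ⟨ρ, h1, h2⟩ := gauss_final a N ha hN c h
  refine ⟨ρ, h1, ?_⟩
  rw [← h2]
  cases N with
  | zero => exact absurd rfl (NeZero.ne 0)
  | succ N => rfl

lemma ph_add (a : ℕ) (c k m : ℤ) : ph a c (k + m) =
    ph a c k * cexp (2 * Real.pi * I * (k * m / a)) * cexp (Real.pi * I * (m * m / a + c * m / a)) := by
  rw [ph, ph, ← Complex.exp_add, ← Complex.exp_add]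
  congr 1
  push_cast; ring

lemma exists_ortho {n : ℕ} (P : Matrix (Fin n) (Fin n) ℤ) (hsymm : P.IsSymm) :
    ∃ e : Fin n → Fin n → ℤ, (∀ i, e i ≠ 0) ∧ ∀ i j, i ≠ j → e i ⬝ᵥ P *ᵥ e j = 0 := by
  have hB : LinearMap.IsSymm (Matrix.toBilin' (P.map (Int.cast : ℤ → ℚ))) := by
    constructor
    intro x y
    simp only [Matrix.toBilin'_apply', RingHom.id_apply]
    rw [Matrix.dotProduct_mulVec, ← Matrix.mulVec_transpose, dotProduct_comm]
    congr 2
    ext i j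
    simp [Matrix.transpose_apply, hsymm.apply]
  obtain ⟨v, hv⟩ := LinearMap.BilinForm.exists_orthogonal_basis hB
  have hn : Module.finrank ℚ (Fin n → ℚ) = n := by simp
  let w : Fin n → Fin n → ℚ := fun i => v (Fin.cast hn.symm i)
  have hw0 : ∀ i, w i ≠ 0 := fun i => v.ne_zero _
  have hwo : ∀ i j, i ≠ j → w i ⬝ᵥ (P.map (Int.cast : ℤ → ℚ)) *ᵥ w j = 0 := by
    intro i j hij
    have := hv (i := Fin.cast hn.symm i) (j := Fin.cast hn.symm j)
      (by intro h; apply hij; simpa using h)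
    simpa [Function.onFun, Matrix.toBilin'_apply'] using this
  have hint : ∀ i, ∃ (d : ℤ) (f : Fin n → ℤ), d ≠ 0 ∧ (fun j => (f j : ℚ)) = (d:ℚ) • w i := by
    intro i
    obtain ⟨b, hb⟩ := IsLocalization.exist_integer_multiples (nonZeroDivisors ℤ) Finset.univ (w i)
    choose f hf using fun j => hb j (Finset.mem_univ j)
    refine ⟨b, f, nonZeroDivisors.coe_ne_zero b, ?_⟩
    funext j
    have := hf j
    simpa [Algebra.smul_def] using this
  choose d f hd hf using hint
  refine ⟨f, ?_, ?_⟩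
  · intro i h0
    have := hf i
    rw [h0] at this
    have h1 : (d i : ℚ) • w i = 0 := by rw [← this]; ext; simp
    rcases smul_eq_zero.1 h1 with h2 | h2
    · exact hd i (by exact_mod_cast h2)
    · exact hw0 i h2
  · intro i j hij
    have h1 : ((f i ⬝ᵥ P *ᵥ f j : ℤ) : ℚ) =
        (fun k => (f i k : ℚ)) ⬝ᵥ (P.map (Int.cast : ℤ → ℚ)) *ᵥ (fun k => (f j k : ℚ)) := by
      simp [dotProduct, Matrix.mulVec]
    have : ((f i ⬝ᵥ P *ᵥ f j : ℤ) : ℚ) = 0 := by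
      rw [h1, hf, hf, Matrix.mulVec_smul, smul_dotProduct, dotProduct_smul, hwo i j hij]; simp
    exact_mod_cast this

section
variable {n : ℕ} (P : Matrix (Fin n) (Fin n) ℤ) (E : Matrix (Fin n) (Fin n) ℤ)
  (a : Fin n → ℕ)

lemma mat_ids (hsymm : P.IsSymm) (ha : ∀ i, 0 < a i)
    (hE : Eᵀ * P * E = Matrix.diagonal (fun i => (a i : ℤ))) :
    (∀ z w : Fin n → ℤ, ∑ i, ((((Eᵀ * P) *ᵥ z) i : ℤ) : ℂ) * (((Eᵀ * P) *ᵥ w) i : ℤ) / a i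
      = (z ⬝ᵥ P *ᵥ w : ℤ)) ∧
    (∀ k u : Fin n → ℤ, (∀ j, ∑ i, (k i : ℂ) * ((Eᵀ * P) i j : ℤ) / a i = u j) → k = Eᵀ *ᵥ u) := by
  let κ : ℤ →+* ℂ := Int.castRingHom ℂ
  set M := Eᵀ * P with hM
  let V : Matrix (Fin n) (Fin n) ℂ := Matrix.diagonal (fun i => (1 / a i : ℂ))
  have h1 : V * (M.map κ * E.map κ) = 1 := by
    rw [← Matrix.map_mul, hE]
    ext i j
    simp only [V, Matrix.diagonal_mul, Matrix.map_apply]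
    by_cases hij : i = j
    · subst hij
      have : (a i : ℂ) ≠ 0 := by exact_mod_cast (ha i).ne'
      simp [κ, this]
    · simp [hij]
  have h2 : E.map κ * (V * M.map κ) = 1 := by
    rw [mul_eq_one_comm, Matrix.mul_assoc]; exact h1
  have hMT : Mᵀ = P * E := by
    rw [hM, Matrix.transpose_mul, Matrix.transpose_transpose, hsymm.eq]
  have h3 : (M.map κ)ᵀ * (V * M.map κ) = P.map κ := by
    rw [← Matrix.transpose_map, hMT, Matrix.map_mul, Matrix.mul_assoc, h2, Matrix.mul_one]
  have hc : ∀ (A : Matrix (Fin n) (Fin n) ℤ) (z : Fin n → ℤ) i,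
      (((A *ᵥ z) i : ℤ) : ℂ) = (A.map κ *ᵥ (fun j => (z j : ℂ))) i := by
    intro A z i; simp [Matrix.mulVec, dotProduct, κ]
  constructor
  · intro z w
    have h4 : ((z ⬝ᵥ P *ᵥ w : ℤ) : ℂ) =
        (fun j => (z j : ℂ)) ⬝ᵥ (P.map κ *ᵥ (fun j => (w j : ℂ))) := by
      simp only [dotProduct, Int.cast_sum, Int.cast_mul, hc]
    have h8 : ∀ x y : Fin n → ℂ, x ⬝ᵥ ((M.map κ)ᵀ * (V * M.map κ)) *ᵥ y =
        (M.map κ *ᵥ x) ⬝ᵥ (V *ᵥ (M.map κ *ᵥ y)) := by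
      intro x y
      rw [← Matrix.mulVec_mulVec, Matrix.dotProduct_mulVec, Matrix.vecMul_transpose,
        ← Matrix.mulVec_mulVec]
    rw [h4, ← h3, h8]
    simp only [dotProduct, hc, V, Matrix.mulVec_diagonal]
    exact Finset.sum_congr rfl fun i _ => by ring
  · intro k u hu
    have h5 : (fun i => (k i : ℂ)) ᵥ* (V * M.map κ) = fun j => (u j : ℂ) := by
      rw [← Matrix.vecMul_vecMul]
      funext j
      rw [← hu j]
      simp only [Matrix.vecMul, dotProduct, V, Matrix.diagonal_apply, Matrix.map_apply, κ]
      refine Finset.sum_congr rfl fun i _ => ?_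
      simp; ring
    have h6 : (fun j => (u j : ℂ)) ᵥ* (E.map κ) = fun i => (k i : ℂ) := by
      rw [← h5, Matrix.vecMul_vecMul, Matrix.mul_assoc, h1, Matrix.vecMul_one]
    funext i
    have h7 := congrFun h6 i
    rw [← Matrix.mulVec_transpose, ← Matrix.transpose_map, ← hc] at h7
    exact_mod_cast h7.symm

end

lemma van_der_blij {n : ℕ} (P : Matrix (Fin n) (Fin n) ℤ) (hsymm : P.IsSymm)
    (hpos : ∀ x : Fin n → ℤ, x ≠ 0 → 0 < x ⬝ᵥ P *ᵥ x) (hdet : P.det = 1)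
    (ξ : Fin n → ℤ) (hξ : ∀ x : Fin n → ℤ, 2 ∣ (x ⬝ᵥ P *ᵥ ξ - x ⬝ᵥ P *ᵥ x)) :
    (8:ℤ) ∣ n - ξ ⬝ᵥ P *ᵥ ξ := by
  obtain ⟨e, he0, heo⟩ := exists_ortho P hsymm
  let a : Fin n → ℕ := fun i => (e i ⬝ᵥ P *ᵥ e i).toNat
  have haz : ∀ i, (a i : ℤ) = e i ⬝ᵥ P *ᵥ e i := fun i => Int.toNat_of_nonneg (hpos _ (he0 i)).le
  have ha : ∀ i, 0 < a i := fun i => by have := hpos _ (he0 i); have := haz i; omega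
  let E : Matrix (Fin n) (Fin n) ℤ := Matrix.of fun j i => e i j
  have hMz : ∀ z i, ((Eᵀ * P) *ᵥ z) i = e i ⬝ᵥ P *ᵥ z := by
    intro z i; rw [← Matrix.mulVec_mulVec]; rfl
  have hE : Eᵀ * P * E = Matrix.diagonal (fun i => (a i : ℤ)) := by
    ext i j
    have : (Eᵀ * P * E) i j = ((Eᵀ * P) *ᵥ (e j)) i := rfl
    rw [this, hMz, Matrix.diagonal_apply]
    split_ifs with hij
    · subst hij; exact (haz i).symm
    · exact heo i j hij
  obtain ⟨id1, id2⟩ := mat_ids P E a hsymm ha hE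
  set M := Eᵀ * P with hM
  let c : Fin n → ℤ := M *ᵥ ξ
  have hca : ∀ i, 2 ∣ c i - a i := by
    intro i; rw [haz]; simp only [c]; rw [hMz]; exact hξ (e i)
  let N : ℕ := ∏ i, a i
  have hN0 : N ≠ 0 := Finset.prod_ne_zero_iff.2 fun i _ => (ha i).ne'
  have : NeZero N := ⟨hN0⟩
  have haN : ∀ i, a i ∣ N := fun i => Finset.dvd_prod_of_mem a (Finset.mem_univ i)
  let F : (Fin n → ℤ) → ℂ := fun k => ∏ i, ph (a i) (c i) (k i)
  let χ : (Fin n → ℤ) → (Fin n → ℤ) → ℂ := fun k z =>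
    cexp (2 * Real.pi * I * ∑ i, (k i : ℂ) * ((M *ᵥ z) i : ℤ) / a i)
  have hF0 : ∀ k, F k ≠ 0 := fun k => Finset.prod_ne_zero_iff.2 fun i _ => Complex.exp_ne_zero _
  have hFper : ∀ k k' : Fin n → ℤ, (∀ i, (k i : ZMod N) = k' i) → F k = F k' := by
    intro k k' h
    refine Finset.prod_congr rfl fun i _ => ?_
    have h1 := (ZMod.intCast_eq_intCast_iff_dvd_sub _ _ _).1 (h i)
    have h2 : (a i : ℤ) ∣ k' i - k i := (Int.natCast_dvd_natCast.2 (haN i)).trans h1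
    obtain ⟨m, hm⟩ := h2
    have : k' i = a i * m + k i := by linarith
    rw [this, ph_period _ (ha i) _ (hca i)]
  have hFadd : ∀ k z, F (k + M *ᵥ z) = F k * χ k z := by
    intro k z
    have h1 : F (k + M *ᵥ z) = F k * χ k z *
        cexp (Real.pi * I * ((z ⬝ᵥ P *ᵥ z : ℤ) + (ξ ⬝ᵥ P *ᵥ z : ℤ))) := by
      rw [← id1, ← id1, ← Finset.sum_add_distrib]
      simp only [F, χ, Pi.add_apply, ph_add, Finset.prod_mul_distrib, Finset.mul_sum,
        Complex.exp_sum]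
      rfl
    rw [h1]
    have hs : ξ ⬝ᵥ P *ᵥ z = z ⬝ᵥ P *ᵥ ξ := by
      rw [Matrix.dotProduct_mulVec, ← Matrix.mulVec_transpose, dotProduct_comm, hsymm.eq]
    obtain ⟨t, ht⟩ := hξ z
    rw [exp_two_pi_int _ (t + z ⬝ᵥ P *ᵥ z), mul_one]
    have : z ⬝ᵥ P *ᵥ ξ = 2 * t + z ⬝ᵥ P *ᵥ z := by linarith
    rw [hs, this]; push_cast; ring
  have hF00 : F 0 = 1 := by simp [F, ph]
  have hFM : ∀ x, F (M *ᵥ x) = 1 := by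
    intro x
    have := hFadd 0 x
    rw [zero_add, hF00] at this
    rw [this]; simp [χ]
  have hχadd : ∀ k z w, χ k (z + w) = χ k z * χ k w := by
    intro k z w
    simp only [χ, ← Complex.exp_add]
    congr 1
    rw [← mul_add, ← Finset.sum_add_distrib]
    congr 1
    refine Finset.sum_congr rfl fun i _ => ?_
    rw [Matrix.mulVec_add]; simp; ring
  -- lifts
  let l : (Fin n → ZMod N) → (Fin n → ℤ) := fun κ i => ((κ i).val : ℤ)
  have hl : ∀ κ i, ((l κ i : ℤ) : ZMod N) = κ i := by intro κ i; simp [l]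
  let Mb : Matrix (Fin n) (Fin n) (ZMod N) := M.map (Int.castRingHom (ZMod N))
  have hMb : ∀ (z : Fin n → ℤ) (ζ : Fin n → ZMod N), (∀ i, ((z i : ℤ) : ZMod N) = ζ i) →
      ∀ i, (((M *ᵥ z) i : ℤ) : ZMod N) = (Mb *ᵥ ζ) i := by
    intro z ζ h i
    simp [Matrix.mulVec, dotProduct, Mb, h]
  let S : ℂ := ∑ κ : Fin n → ZMod N, F (l κ)
  have hshift : ∀ ζ : Fin n → ZMod N, S = ∑ κ : Fin n → ZMod N, F (l κ + M *ᵥ l ζ) := by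
    intro ζ
    simp only [S]
    rw [← Equiv.sum_comp (Equiv.addRight (Mb *ᵥ ζ))]
    refine Finset.sum_congr rfl fun κ _ => hFper _ _ fun i => ?_
    rw [hl, Pi.add_apply, Int.cast_add, hl, hMb _ _ (hl ζ)]
    rfl
  have hinner : ∀ k : Fin n → ℤ, ∃ t : ℝ, 0 ≤ t ∧
      ∑ ζ : Fin n → ZMod N, F (k + M *ᵥ l ζ) = t := by
    intro k
    by_cases hall : ∀ j, χ k (Pi.single j 1) = 1
    · have : ∀ j, ∃ u : ℤ, ∑ i, (k i : ℂ) * (M i j : ℤ) / a i = u := by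
        intro j
        obtain ⟨u, hu⟩ := Complex.exp_eq_one_iff.1 (hall j)
        refine ⟨u, ?_⟩
        have h2 : (2 * Real.pi * I : ℂ) ≠ 0 := Complex.two_pi_I_ne_zero
        have h3 : ∀ i, (M *ᵥ (Pi.single j 1 : Fin n → ℤ)) i = M i j := by
          intro i; simp
        simp only [h3] at hu
        rw [mul_comm] at hu
        exact mul_right_cancel₀ h2 hu
      choose u hu using this
      have hk := id2 k u hu
      have hk2 : k = M *ᵥ (P.adjugate *ᵥ u) := by
        rw [hk, hM, Matrix.mulVec_mulVec, Matrix.mul_assoc, Matrix.mul_adjugate, hdet]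
        simp
      refine ⟨Fintype.card (Fin n → ZMod N), by positivity, ?_⟩
      have : ∀ ζ : Fin n → ZMod N, F (k + M *ᵥ l ζ) = 1 := by
        intro ζ
        rw [hk2, ← Matrix.mulVec_add, hFM]
      simp [this]
    · push Not at hall
      obtain ⟨j, hj⟩ := hall
      refine ⟨0, le_rfl, ?_⟩
      have h1 : ∑ ζ : Fin n → ZMod N, F (k + M *ᵥ l ζ) =
          (∑ ζ : Fin n → ZMod N, F (k + M *ᵥ l ζ)) * χ k (Pi.single j 1) := by
        conv_lhs => rw [← Equiv.sum_comp (Equiv.addRight (Pi.single j (1 : ZMod N)))]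
        rw [Finset.sum_mul]
        refine Finset.sum_congr rfl fun ζ _ => ?_
        have : F (k + M *ᵥ l (ζ + Pi.single j 1)) = F (k + M *ᵥ (l ζ + Pi.single j 1)) := by
          refine hFper _ _ fun i => ?_
          rw [Pi.add_apply, Pi.add_apply, Int.cast_add, Int.cast_add, hMb _ _ (hl _),
            hMb _ (ζ + Pi.single j 1)]
          intro i
          rw [Pi.add_apply, Int.cast_add, hl, Pi.add_apply]
          congr 1
          by_cases hij : i = j
          · subst hij; simp
          · simp [hij]
        rw [Equiv.coe_addRight, this, hFadd, hFadd, hχadd, mul_assoc]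
      have h2 : (∑ ζ : Fin n → ZMod N, F (k + M *ᵥ l ζ)) * (χ k (Pi.single j 1) - 1) = 0 := by
        rw [mul_sub, ← h1]; ring
      rcases mul_eq_zero.1 h2 with h3 | h3
      · simpa using h3
      · exact absurd (sub_eq_zero.1 h3) hj
  choose t ht0 ht using hinner
  have hS1 : (Fintype.card (Fin n → ZMod N) : ℂ) * S =
      ((∑ κ : Fin n → ZMod N, t (l κ) : ℝ) : ℂ) := by
    have : (Fintype.card (Fin n → ZMod N) : ℂ) * S = ∑ ζ : Fin n → ZMod N, S := by simp
    rw [this, Finset.sum_congr rfl fun ζ _ => hshift ζ, Finset.sum_comm, ofReal_sum]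
    exact Finset.sum_congr rfl fun κ _ => ht _
  have hS2 : S = ∏ i, ∑ r : ZMod N, ph (a i) (c i) (r.val : ℕ) := by
    rw [Finset.prod_univ_sum, Fintype.piFinset_univ]
  choose ρ hρ hρ2 using fun i => gauss_zmod (a i) N (ha i) (haN i) (c i) (hca i)
  have hS3 : S = ((∏ i, ρ i : ℝ) : ℂ) * cexp (Real.pi * I / 4 * (n - (ξ ⬝ᵥ P *ᵥ ξ : ℤ))) := by
    rw [hS2, Finset.prod_congr rfl fun i _ => hρ2 i, Finset.prod_mul_distrib, ofReal_prod,
      ← Complex.exp_sum, ← Finset.mul_sum, Finset.sum_sub_distrib, ← id1]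
    congr 4
    · simp
    · exact Finset.sum_congr rfl fun i _ => by simp only [c]; ring
  have hR : 0 < ∏ i, ρ i := Finset.prod_pos fun i _ => hρ i
  set R := ∏ i, ρ i
  set T := ∑ κ : Fin n → ZMod N, t (l κ) with hT
  have hT0 : 0 ≤ T := Finset.sum_nonneg fun κ _ => ht0 _
  have hcard : 0 < (Fintype.card (Fin n → ZMod N) : ℝ) := by exact_mod_cast Fintype.card_pos
  set K : ℝ := (Fintype.card (Fin n → ZMod N) : ℝ) with hK
  have hK' : (Fintype.card (Fin n → ZMod N) : ℂ) = (K : ℂ) := by rw [hK]; push_cast; rfl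
  rw [hK', hS3] at hS1
  have hRc : (R:ℂ) ≠ 0 := by exact_mod_cast hR.ne'
  have hKc : (K:ℂ) ≠ 0 := by exact_mod_cast hcard.ne'
  have hexp : cexp (Real.pi * I / 4 * (n - (ξ ⬝ᵥ P *ᵥ ξ : ℤ))) = ((T / (K * R) : ℝ) : ℂ) := by
    push_cast
    rw [eq_div_iff (mul_ne_zero hKc hRc), ← hS1]; ring
  have hnorm : ‖cexp (Real.pi * I / 4 * (n - (ξ ⬝ᵥ P *ᵥ ξ : ℤ)))‖ = 1 := by
    have : (Real.pi * I / 4 * (n - (ξ ⬝ᵥ P *ᵥ ξ : ℤ)) : ℂ) =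
        ((Real.pi / 4 * (n - (ξ ⬝ᵥ P *ᵥ ξ : ℤ)) : ℝ) : ℂ) * I := by push_cast; ring
    rw [this, Complex.norm_exp_ofReal_mul_I]
  have h1 : T / (K * R) = 1 := by
    rw [hexp, Complex.norm_real, Real.norm_of_nonneg (by positivity)] at hnorm
    exact hnorm
  rw [h1, ofReal_one] at hexp
  obtain ⟨m, hm⟩ := Complex.exp_eq_one_iff.1 hexp
  refine ⟨m, ?_⟩
  have h2 : (Real.pi * I : ℂ) ≠ 0 := mul_ne_zero (by exact_mod_cast Real.pi_ne_zero) I_ne_zero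
  have h3 : (n:ℂ) - (ξ ⬝ᵥ P *ᵥ ξ : ℤ) = 8 * m := by
    apply mul_left_cancel₀ h2
    linear_combination 4 * hm
  exact_mod_cast h3

end Helpers

/-- Let `L = ℤⁿ` (Gram matrix `P`) be an exceptional unimodular lattice with
`n ≡ 5 (mod 8)` all of whose nonzero vectors have norm ≥ 3. Then `L` has exactly 2
characteristic vectors of norm `< 8`. -/
theorem two_exceptional_vectors_of_no_short_vectors
    {n : ℕ} (P : Matrix (Fin n) (Fin n) ℤ) (hsymm : P.IsSymm)
    (hpos : ∀ x : Fin n → ℤ, x ≠ 0 → 0 < x ⬝ᵥ P *ᵥ x) (hdet : P.det = 1)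
    (h5 : n % 8 = 5) (hmin : ∀ x : Fin n → ℤ, x ≠ 0 → 3 ≤ x ⬝ᵥ P *ᵥ x)
    (hexc : ∃ ξ : Fin n → ℤ, (∀ x : Fin n → ℤ, 2 ∣ (x ⬝ᵥ P *ᵥ ξ - x ⬝ᵥ P *ᵥ x)) ∧
      ξ ⬝ᵥ P *ᵥ ξ < 8) :
    Nat.card {ξ : Fin n → ℤ //
      (∀ x : Fin n → ℤ, 2 ∣ (x ⬝ᵥ P *ᵥ ξ - x ⬝ᵥ P *ᵥ x)) ∧ ξ ⬝ᵥ P *ᵥ ξ < 8} = 2 := by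
  obtain ⟨ξ, hξ, hξ8⟩ := hexc
  have hnn : ∀ x : Fin n → ℤ, 0 ≤ x ⬝ᵥ P *ᵥ x := by
    intro x
    by_cases h : x = 0
    · simp [h]
    · exact (hpos x h).le
  have h5' : ∀ η : Fin n → ℤ, (∀ x : Fin n → ℤ, 2 ∣ (x ⬝ᵥ P *ᵥ η - x ⬝ᵥ P *ᵥ x)) →
      η ⬝ᵥ P *ᵥ η < 8 → η ⬝ᵥ P *ᵥ η = 5 := by
    intro η h1 h2
    have := van_der_blij P hsymm hpos hdet η h1
    have := hnn η
    omega
  have hξ5 := h5' ξ hξ hξ8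
  have hξ0 : ξ ≠ -ξ := by
    intro h
    have h0 : ξ = 0 := by
      funext i; have := congrFun h i; simp at this; simp; omega
    rw [h0] at hξ5; simp at hξ5
  have hset : {η : Fin n → ℤ | (∀ x : Fin n → ℤ, 2 ∣ (x ⬝ᵥ P *ᵥ η - x ⬝ᵥ P *ᵥ x)) ∧
      η ⬝ᵥ P *ᵥ η < 8} = {ξ, -ξ} := by
    ext η
    simp only [Set.mem_ofPred_eq, Set.mem_insert_iff, Set.mem_singleton_iff]
    constructor
    · rintro ⟨h1, h2⟩
      have hη5 := h5' η h1 h2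
      have hu : ∀ i, ∃ u, (P *ᵥ (ξ - η)) i = 2 * u := by
        intro i
        have e1 := hξ (Pi.single i 1)
        have e2 := h1 (Pi.single i 1)
        have := dvd_sub e1 e2
        rw [Matrix.mulVec_sub, Pi.sub_apply]
        simp only [single_one_dotProduct] at this
        obtain ⟨u, hu⟩ := this
        exact ⟨u, by linarith⟩
      choose u hu using hu
      set v := P.adjugate *ᵥ u with hv
      have hxv : ξ = η + v + v := by
        have h3 : P *ᵥ (ξ - η) = u + u := by funext i; rw [hu i, Pi.add_apply]; ring
        have h4 : P.adjugate *ᵥ (P *ᵥ (ξ - η)) = v + v := by rw [h3, Matrix.mulVec_add]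
        rw [Matrix.mulVec_mulVec, Matrix.adjugate_mul, hdet] at h4
        simp only [one_smul, Matrix.one_mulVec] at h4
        rw [add_assoc, ← h4]; simp
      have hsy : ∀ x y : Fin n → ℤ, x ⬝ᵥ P *ᵥ y = y ⬝ᵥ P *ᵥ x := by
        intro x y
        rw [Matrix.dotProduct_mulVec, ← Matrix.mulVec_transpose, dotProduct_comm, hsymm.eq]
      have key : v ⬝ᵥ P *ᵥ v + (η + v) ⬝ᵥ P *ᵥ (η + v) = 5 := by
        have e := hξ5
        rw [hxv] at e
        simp only [Matrix.mulVec_add, add_dotProduct, dotProduct_add] at e ⊢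
        have := hsy η v
        linarith
      by_cases hv0 : v = 0
      · left; rw [hxv, hv0]; simp
      · by_cases hw0 : η + v = 0
        · right
          have : v = -η := by rw [← add_eq_zero_iff_neg_eq.1 hw0]
          rw [hxv, hw0, this]; simp
        · have := hmin v hv0
          have := hmin _ hw0
          omega
    · rintro (rfl | rfl)
      · exact ⟨hξ, hξ8⟩
      · refine ⟨fun x => ?_, ?_⟩
        · have := hξ x
          rw [Matrix.mulVec_neg, dotProduct_neg]
          omega
        · rw [Matrix.mulVec_neg, dotProduct_neg, neg_dotProduct, neg_neg]; exact hξ8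
  have h6 := Set.ncard_pair hξ0
  rw [← hset] at h6
  exact h6
end
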